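/- arXiv:2509.26028 — 8 statements merged into one kernel-verified Lean document; each statement's English description precedes it below -/
import Mathlib

section
/- Let H be a finite simple graph with maximum degree at most Δ. For every i ∈ ℕ and every k ≥ Δ^i + 1, there exists a partition of the vertex set of H into k parts such that (i) any two distinct vertices lying in the same part are at graph distance at least i + 1 in H (in particular, vertices in different connected components, which are at infinite distance, may share a part), and (ii) the sizes of any two parts differ by at most 1. -/
namespace EquitableColoring

section Digraph

open scoped Classical

/-- `Reaches r a D c` says that there is a directed `r`-path from `c` to `a` inside `D`. -/
inductive Reaches {C : Type*} (r : C → C → Prop) (a : C) (D : Finset C) : C → Prop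
  | refl : a ∈ D → Reaches r a D a
  | head {x y : C} : x ∈ D → r x y → Reaches r a D y → Reaches r a D x

variable {C : Type*} {r : C → C → Prop} {a c : C} {D E : Finset C}

lemma Reaches.mem (h : Reaches r a D c) : c ∈ D := by
  cases h <;> assumption

lemma Reaches.target_mem (h : Reaches r a D c) : a ∈ D := by
  induction h <;> assumption

lemma Reaches.mono {r' : C → C → Prop} (h : Reaches r a D c) (hDE : D ⊆ E)
    (hr : ∀ x ∈ D, ∀ y ∈ D, r x y → r' x y) : Reaches r' a E c := by
  induction h with
  | refl h => exact .refl (hDE h)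
  | head hx hxy hy ih => exact .head (hDE hx) (hr _ hx _ hy.mem hxy) ih

/-- The last exit of a path from its starting point. -/
lemma Reaches.exists_erase (h : Reaches r a D c) (hca : c ≠ a) :
    ∃ d, r c d ∧ Reaches r a (D.erase c) d := by
  have key : ∀ x, Reaches r a D x →
      Reaches r a (D.erase c) x ∨ ∃ d, r c d ∧ Reaches r a (D.erase c) d := by
    intro x hx
    induction hx with
    | refl h => exact .inl (.refl (Finset.mem_erase.2 ⟨hca.symm, h⟩))
    | @head x y hx hxy _ ih =>
      rcases ih with ih | ih
      · by_cases hxc : x = c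
        · exact .inr ⟨y, hxc ▸ hxy, ih⟩
        · exact .inl (.head (Finset.mem_erase.2 ⟨hxc, hx⟩) hxy ih)
      · exact .inr ih
  rcases key c h with h | h
  · exact absurd h.mem (Finset.notMem_erase c D)
  · exact h

variable [Fintype C]

/-- The set of vertices from which `a` can be reached. -/
noncomputable def accessible (r : C → C → Prop) (a : C) : Finset C :=
  {c | Reaches r a Finset.univ c}

lemma mem_accessible : c ∈ accessible r a ↔ Reaches r a Finset.univ c := by
  simp [accessible]

lemma self_mem_accessible : a ∈ accessible r a :=
  mem_accessible.2 (.refl (Finset.mem_univ _))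

lemma mem_accessible_of_rel {x y : C} (hxy : r x y) (hy : y ∈ accessible r a) :
    x ∈ accessible r a :=
  mem_accessible.2 (.head (Finset.mem_univ _) hxy (mem_accessible.1 hy))

lemma reaches_accessible (h : c ∈ accessible r a) : Reaches r a (accessible r a) c := by
  have h := mem_accessible.1 h
  induction h with
  | refl h => exact .refl self_mem_accessible
  | head hx hxy hy ih =>
    have hy' := mem_accessible.2 hy
    exact .head (mem_accessible_of_rel hxy hy') hxy (ih hy')

/-- In the set of accessible vertices there are a vertex `U` and a nonempty set `T` of
vertices, none of which is needed by the other accessible vertices in order to reach `a`, such that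
all arcs leaving `T` inside the accessible set go to `U`. -/
lemma exists_terminal (hc : c ∈ accessible r a) (hca : c ≠ a) :
    ∃ U ∈ accessible r a, ∃ T ⊆ accessible r a, T.Nonempty ∧ U ∉ T ∧ a ∉ T ∧
      (∀ x ∈ T, ∀ d ∈ accessible r a, d ≠ U → d ∉ T → ¬ r x d) ∧
      ∀ W ∈ T, ∀ x ∈ accessible r a, x ≠ W → Reaches r a ((accessible r a).erase W) x := by
  set A := accessible r a with hA
  let T : C → Finset C := fun U => {x ∈ A | x ≠ U ∧ ¬ Reaches r a (A.erase U) x}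
  have hT : ∀ U x, x ∈ T U ↔ x ∈ A ∧ x ≠ U ∧ ¬ Reaches r a (A.erase U) x := by
    intro U x; simp [T]
  have hne : ({U ∈ A | (T U).Nonempty} : Finset C).Nonempty := by
    refine ⟨a, ?_⟩
    simp only [Finset.mem_filter]
    refine ⟨self_mem_accessible, c, (hT _ _).2 ⟨hc, hca, fun h => ?_⟩⟩
    exact absurd h.target_mem (Finset.notMem_erase _ _)
  obtain ⟨U, hU, hmin⟩ := Finset.exists_min_image _ (fun U => (T U).card) hne
  simp only [Finset.mem_filter] at hU hmin
  have haT : ∀ x, Reaches r a (A.erase U) x → x ∉ T U := fun x hx h => ((hT _ _).1 h).2.2 hx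
  refine ⟨U, hU.1, T U, Finset.filter_subset _ _, hU.2, fun h => ((hT _ _).1 h).2.1 rfl, ?_, ?_, ?_⟩
  · intro h
    obtain ⟨h1, h2, h3⟩ := (hT _ _).1 h
    exact h3 (.refl (Finset.mem_erase.2 ⟨h2, h1⟩))
  · intro x hx d hd hdU hdT hxd
    obtain ⟨h1, h2, h3⟩ := (hT _ _).1 hx
    have hdr : Reaches r a (A.erase U) d := by
      by_contra hcon
      exact hdT ((hT _ _).2 ⟨hd, hdU, hcon⟩)
    exact h3 (.head (Finset.mem_erase.2 ⟨h2, h1⟩) hxd hdr)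
  · intro W hW x hx hxW
    by_contra hcon
    have hxT : x ∈ T W := (hT _ _).2 ⟨hx, hxW, hcon⟩
    obtain ⟨hWA, hWU, -⟩ := (hT _ _).1 hW
    have hreach : ∀ y, Reaches r a (A.erase U) y → Reaches r a (A.erase W) y := by
      intro y hy
      induction hy with
      | refl h =>
        refine .refl (Finset.mem_erase.2 ⟨?_, self_mem_accessible⟩)
        rintro rfl
        exact haT _ (.refl h) hW
      | @head y z hy hyz hz ih =>
        refine .head (Finset.mem_erase.2 ⟨?_, Finset.mem_of_mem_erase hy⟩) hyz ih
        rintro rfl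
        exact haT _ (.head hy hyz hz) hW
    have hUr : Reaches r a (A.erase W) U := by
      by_cases hUa : U = a
      · rw [hUa]
        exact .refl (Finset.mem_erase.2 ⟨fun h => hWU (h ▸ hUa.symm), self_mem_accessible⟩)
      · obtain ⟨d, hd, hdr⟩ := (reaches_accessible hU.1).exists_erase hUa
        exact .head (Finset.mem_erase.2 ⟨hWU.symm, hU.1⟩) hd (hreach d hdr)
    have hss : T W ⊂ T U := by
      refine Finset.ssubset_iff_subset_ne.2 ⟨?_, ?_⟩
      · intro y hy
        obtain ⟨h1, h2, h3⟩ := (hT _ _).1 hy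
        refine (hT _ _).2 ⟨h1, ?_, fun h => h3 (hreach y h)⟩
        rintro rfl
        exact h3 hUr
      · intro h
        rw [← h] at hW
        exact ((hT _ _).1 hW).2.1 rfl
    exact absurd (hmin W ⟨hWA, x, hxT⟩) (not_le.2 (Finset.card_lt_card hss))

end Digraph

section Coloring

open scoped Classical

variable {V C : Type*} {G : SimpleGraph V} {f : V → C}

/-- `f` is a proper colouring of `G`. -/
def IsProper (G : SimpleGraph V) (f : V → C) : Prop := ∀ u v, G.Adj u v → f u ≠ f v

/-- The vertex `v` has no neighbour of colour `c`. -/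
def Movable (G : SimpleGraph V) (f : V → C) (v : V) (c : C) : Prop := ∀ w, G.Adj v w → f w ≠ c

/-- Some vertex of colour `c` can be recoloured with `d`. -/
def Arc (G : SimpleGraph V) (f : V → C) (c d : C) : Prop := ∃ v, f v = c ∧ Movable G f v d

lemma IsProper.update (hf : IsProper G f) {y : V} {d : C} (hy : Movable G f y d) :
    IsProper G (Function.update f y d) := by
  intro u v huv
  have hne := huv.ne
  by_cases hu : u = y
  · subst hu
    rw [Function.update_self, Function.update_of_ne hne.symm]
    exact (hy v huv).symm
  · by_cases hv : v = y
    · subst hv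
      rw [Function.update_self, Function.update_of_ne hne]
      exact hy u huv.symm
    · rw [Function.update_of_ne hu, Function.update_of_ne hv]
      exact hf u v huv

variable [Fintype V]

/-- The number of vertices of colour `c`. -/
noncomputable def classCard (f : V → C) (c : C) : ℕ := Finset.card {v | f v = c}

lemma classCard_update (f : V → C) (y : V) (d c : C) :
    classCard (Function.update f y d) c + (if c = f y then 1 else 0) =
      classCard f c + (if c = d then 1 else 0) := by
  have h : ∀ g : V → C, classCard g c =
      Finset.card {v ∈ Finset.univ.erase y | g v = c} + (if c = g y then 1 else 0) := by
    intro g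
    rw [classCard, ← Finset.insert_erase (Finset.mem_univ y), Finset.filter_insert]
    simp only [Finset.insert_erase (Finset.mem_univ y), eq_comm (a := c)]
    split_ifs
    · rw [Finset.card_insert_of_notMem (by simp)]
    · rfl
  rw [h f, h (Function.update f y d), Function.update_self]
  have : Finset.filter (fun v => Function.update f y d v = c) (Finset.univ.erase y) =
      Finset.filter (fun v => f v = c) (Finset.univ.erase y) := by
    refine Finset.filter_congr fun v hv => ?_
    rw [Function.update_of_ne (Finset.ne_of_mem_erase hv)]
  rw [this]
  omega

/-- Shifting one vertex along each arc of a path moves one unit of class size from its start to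
its end. -/
lemma exists_shift (hf : IsProper G f) {a c : C} {D : Finset C}
    (h : Reaches (Arc G f) a D c) :
    ∃ f' : V → C, IsProper G f' ∧ (∀ v, f v ∉ D → f' v = f v) ∧ (∀ v, f v ∈ D → f' v ∈ D) ∧
      (∀ v, f' v = c → f v = c) ∧
      ∀ x, classCard f' x + (if x = c then 1 else 0) = classCard f x + (if x = a then 1 else 0) := by
  induction hn : D.card generalizing D c with
  | zero => exact absurd h.mem (by simp [Finset.card_eq_zero.1 hn])
  | succ n ih =>
    by_cases hca : c = a
    · subst hca
      exact ⟨f, hf, fun _ _ => rfl, fun _ h => h, fun _ h => h, fun _ => rfl⟩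
    obtain ⟨d, ⟨y, hyc, hyd⟩, hd⟩ := h.exists_erase hca
    obtain ⟨g, hg, hg1, hg2, hg3, hg4⟩ := ih hd (by rw [Finset.card_erase_of_mem h.mem, hn]; rfl)
    have hcD : ∀ v, g v = c → f v = c := by
      intro v hv
      by_cases hvD : f v ∈ D.erase c
      · exact absurd (hv ▸ hg2 v hvD) (Finset.notMem_erase c D)
      · rw [← hg1 v hvD, hv]
    have hgy : g y = c := by rw [hg1 y (by simp [hyc]), hyc]
    refine ⟨Function.update g y d, hg.update fun w hw hwd => hyd w hw (hg3 w hwd), ?_, ?_, ?_, ?_⟩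
    · intro v hv
      have : v ≠ y := by rintro rfl; exact hv (hyc ▸ h.mem)
      rw [Function.update_of_ne this, hg1 v fun h' => hv (Finset.mem_of_mem_erase h')]
    · intro v hv
      by_cases hvy : v = y
      · subst hvy
        rw [Function.update_self]
        exact Finset.mem_of_mem_erase hd.mem
      · rw [Function.update_of_ne hvy]
        by_cases hvc : f v = c
        · rw [hg1 v (by simp [hvc])]; exact hv
        · exact Finset.mem_of_mem_erase (hg2 v (Finset.mem_erase.2 ⟨hvc, hv⟩))
    · intro v hv
      by_cases hvy : v = y
      · subst hvy; exact hyc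
      · rw [Function.update_of_ne hvy] at hv
        exact hcD v hv
    · intro x
      have h1 := classCard_update g y d x
      have h2 := hg4 x
      rw [hgy] at h1
      omega

end Coloring

section Counting

open scoped Classical

variable {V C : Type*} [Fintype V] {G : SimpleGraph V} {f : V → C}

lemma card_filter_mem (f : V → C) (P : V → Prop) (A : Finset C) :
    Finset.card {w | P w ∧ f w ∈ A} = ∑ c ∈ A, Finset.card {w | P w ∧ f w = c} := by
  rw [Finset.card_eq_sum_card_fiberwise (f := f) (t := A) (fun w hw => by simp_all)]
  refine Finset.sum_congr rfl fun c hc => ?_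
  congr 1
  ext w
  simp only [Finset.mem_filter, Finset.mem_univ, true_and]
  constructor
  · rintro ⟨⟨h1, -⟩, h2⟩; exact ⟨h1, h2⟩
  · rintro ⟨h1, h2⟩; exact ⟨⟨h1, h2 ▸ hc⟩, h2⟩

lemma card_filter_split (f : V → C) (P : V → Prop) (A : Finset C) :
    Finset.card {w | P w ∧ f w ∉ A} + ∑ c ∈ A, Finset.card {w | P w ∧ f w = c} =
      Finset.card {w | P w} := by
  rw [← card_filter_mem, ← Finset.card_filter_add_card_filter_not (s := {w | P w})
    (fun w => f w ∈ A), Finset.filter_filter, Finset.filter_filter, add_comm]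

lemma card_nbrs_outside_add_le {v : V} {A D : Finset C} (hDA : D ⊆ A)
    (h : ∀ c ∈ D, ∃ w, G.Adj v w ∧ f w = c) :
    Finset.card {w | G.Adj v w ∧ f w ∉ A} + D.card ≤ Finset.card {w | G.Adj v w} := by
  rw [← card_filter_split f (G.Adj v) A]
  gcongr
  calc D.card = ∑ c ∈ D, 1 := by simp
    _ ≤ ∑ c ∈ D, Finset.card {w | G.Adj v w ∧ f w = c} := by
      refine Finset.sum_le_sum fun c hc => Finset.card_pos.2 ?_
      obtain ⟨w, hw⟩ := h c hc
      exact ⟨w, by simpa using hw⟩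
    _ ≤ _ := Finset.sum_le_sum_of_subset hDA

lemma sum_card_filter_comm (P Q : V → Prop) [DecidablePred P] [DecidablePred Q]
    (r : V → V → Prop) :
    ∑ y with P y, Finset.card {z | r y z ∧ Q z} =
      ∑ z with Q z, Finset.card {y | r y z ∧ P y} := by
  have := Finset.sum_card_bipartiteAbove_eq_sum_card_bipartiteBelow r
    (s := ({y | P y} : Finset V)) (t := ({z | Q z} : Finset V))
  simp only [Finset.bipartiteAbove, Finset.bipartiteBelow, Finset.filter_filter] at this
  simpa only [and_comm] using this

/-- `z` is the only neighbour of `y` in the colour class of `z`. -/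
def Solo (G : SimpleGraph V) (f : V → C) (z y : V) : Prop :=
  G.Adj y z ∧ ∀ w, G.Adj y w → f w = f z → w = z

lemma two_le_card_add_card_solo {y : V} {c : C} (h : ∃ w, G.Adj y w ∧ f w = c) :
    2 ≤ Finset.card {w | G.Adj y w ∧ f w = c} + Finset.card {z | Solo G f z y ∧ f z = c} := by
  obtain ⟨w, hw, hwc⟩ := h
  have h1 : 1 ≤ Finset.card {w | G.Adj y w ∧ f w = c} :=
    Finset.card_pos.2 ⟨w, by simp [hw, hwc]⟩
  by_cases hs : Solo G f w y
  · have : 1 ≤ Finset.card {z | Solo G f z y ∧ f z = c} :=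
      Finset.card_pos.2 ⟨w, by simp [hs, hwc]⟩
    omega
  · have : ∃ x, G.Adj y x ∧ f x = c ∧ x ≠ w := by
      by_contra! hcon
      exact hs ⟨hw, fun x hx hxc => hcon x hx (hxc.trans hwc)⟩
    obtain ⟨x, hx, hxc, hxw⟩ := this
    have : 1 < Finset.card {w | G.Adj y w ∧ f w = c} :=
      Finset.one_lt_card.2 ⟨x, by simp [hx, hxc], w, by simp [hw, hwc], hxw⟩
    omega

lemma card_add_card_le_of_solo {y : V} {k q : ℕ} {A T : Finset C}
    (hk : A.card + q = k) (hdeg : Finset.card {w | G.Adj y w} < k)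
    (hA : ∀ c ∈ A, ∃ w, G.Adj y w ∧ f w = c) (hTA : T ⊆ A) :
    T.card + (Finset.card {w | G.Adj y w ∧ f w ∉ A} + 1) ≤
      Finset.card {z | Solo G f z y ∧ f z ∈ T} + q := by
  have h1 := card_filter_split f (G.Adj y) A
  have h2 := card_filter_mem f (fun z => Solo G f z y) T
  have h3 := Finset.sum_sdiff hTA (f := fun c => Finset.card {w | G.Adj y w ∧ f w = c})
  have h4 : (A \ T).card ≤ ∑ c ∈ A \ T, Finset.card {w | G.Adj y w ∧ f w = c} := by
    rw [Finset.card_eq_sum_ones]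
    refine Finset.sum_le_sum fun c hc => Finset.card_pos.2 ?_
    obtain ⟨w, hw⟩ := hA c (Finset.mem_sdiff.1 hc).1
    exact ⟨w, by simpa using hw⟩
  have h5 : T.card * 2 ≤ ∑ c ∈ T, (Finset.card {w | G.Adj y w ∧ f w = c} +
      Finset.card {z | Solo G f z y ∧ f z = c}) := by
    rw [← smul_eq_mul]
    exact Finset.card_nsmul_le_sum _ _ _ fun c hc => two_le_card_add_card_solo (hA c (hTA hc))
  rw [Finset.sum_add_distrib] at h5
  have h6 := Finset.card_sdiff_add_card_eq_card hTA
  omega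

/-- If no solo vertex of the class `W` can be moved inside `A`, then `T` is large. -/
lemma lt_card_of_solo_not_movable {k q s : ℕ} {A T : Finset C} {U W : C}
    (hk : A.card + q = k) (hdeg : ∀ v, Finset.card {w | G.Adj v w} < k)
    (hA : ∀ y, f y ∉ A → ∀ c ∈ A, ∃ w, G.Adj y w ∧ f w = c)
    (hB : q * s < Finset.card {y | f y ∉ A}) (hTA : T ⊆ A) (hU : U ∈ A) (hUT : U ∉ T)
    (hT : ∀ x, f x ∈ T → ∀ d ∈ A, d ≠ U → d ∉ T → ∃ w, G.Adj x w ∧ f w = d)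
    (hW : W ∈ T) (hsize : classCard f W = s)
    (hsolo : ∀ z y, f z = W → f y ∉ A → Solo G f z y →
      ∀ X ∈ A, X ≠ W → ∃ w, G.Adj z w ∧ f w = X) : q < T.card := by
  by_contra! hcon
  have h1 : Finset.card {y | f y ∉ A} * 2 ≤ ∑ y with f y ∉ A,
      (Finset.card {w | G.Adj y w ∧ f w = W} + Finset.card {z | Solo G f z y ∧ f z = W}) := by
    rw [← smul_eq_mul]
    exact Finset.card_nsmul_le_sum _ _ _ fun y hy =>
      two_le_card_add_card_solo (hA y (by simpa using hy) W (hTA hW))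
  rw [Finset.sum_add_distrib, sum_card_filter_comm _ _ (fun y z => G.Adj y z),
    sum_card_filter_comm _ _ (fun y z => Solo G f z y), ← Finset.sum_add_distrib] at h1
  have h2 : ∑ z with f z = W, (Finset.card {y | G.Adj y z ∧ f y ∉ A} +
      Finset.card {y | Solo G f z y ∧ f y ∉ A}) ≤ s * (2 * q) := by
    rw [← hsize, classCard, ← smul_eq_mul]
    refine Finset.sum_le_card_nsmul _ _ _ fun z hz => ?_
    have hz : f z = W := by simpa using hz
    have hd := hdeg z
    simp only [G.adj_comm _ z]
    by_cases hex : ∃ y, f y ∉ A ∧ Solo G f z y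
    · obtain ⟨y, hy, hyz⟩ := hex
      have h3 := card_nbrs_outside_add_le (G := G) (f := f) (v := z) (Finset.erase_subset W A)
        fun c hc => hsolo z y hz hy hyz c (Finset.mem_of_mem_erase hc) (Finset.ne_of_mem_erase hc)
      have h4 := Finset.card_erase_add_one (hTA hW)
      have h5 : Finset.card {y | Solo G f z y ∧ f y ∉ A} ≤
          Finset.card {y | G.Adj z y ∧ f y ∉ A} :=
        Finset.card_le_card (Finset.monotone_filter_right _ fun y _ h => ⟨h.1.1.symm, h.2⟩)
      omega
    · have h3 : Finset.card {y | Solo G f z y ∧ f y ∉ A} = 0 := by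
        rw [Finset.card_eq_zero, Finset.filter_eq_empty_iff]
        exact fun y _ h => hex ⟨y, h.2, h.1⟩
      have h4 := card_nbrs_outside_add_le (G := G) (f := f) (v := z) (A := A)
        (D := (A \ T).erase U) ((Finset.erase_subset _ _).trans Finset.sdiff_subset)
        (fun c hc => by
          simp only [Finset.mem_erase, Finset.mem_sdiff] at hc
          exact hT z (hz ▸ hW) c hc.2.1 hc.1 hc.2.2)
      have h5 := Finset.card_erase_add_one (Finset.mem_sdiff.2 ⟨hU, hUT⟩)
      have h6 := Finset.card_sdiff_add_card_eq_card hTA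
      omega
  nlinarith

/-- If special neighbourhoods of solo vertices are cliques, then `T` is not large. -/
lemma card_le_of_solo_clique {k q s : ℕ} {A T : Finset C}
    (hk : A.card + q = k) (hdeg : ∀ v, Finset.card {w | G.Adj v w} < k)
    (hA : ∀ y, f y ∉ A → ∀ c ∈ A, ∃ w, G.Adj y w ∧ f w = c)
    (hB : q * s < Finset.card {y | f y ∉ A}) (hTA : T ⊆ A) (hTne : T.Nonempty)
    (hsize : ∀ c ∈ T, classCard f c = s)
    (hsolo : ∀ z y y', f z ∈ T → f y ∉ A → f y' ∉ A → Solo G f z y → Solo G f z y' →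
      y' ≠ y → G.Adj y y') : T.card < q := by
  by_contra! hcon
  let σ : V → ℕ := fun z => Finset.card {y | Solo G f z y ∧ f y ∉ A}
  have hTs : Finset.card {z | f z ∈ T} = T.card * s := by
    have := card_filter_mem f (fun _ => True) T
    simp only [true_and] at this
    rw [this, ← smul_eq_mul, ← Finset.sum_const]
    exact Finset.sum_congr rfl hsize
  have hlow : (Finset.card {y | f y ∉ A} : ℚ) * T.card ≤
      ∑ y with f y ∉ A, ∑ z with Solo G f z y ∧ f z ∈ T, (q : ℚ) / σ z := by
    rw [← nsmul_eq_mul]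
    refine Finset.card_nsmul_le_sum _ _ _ fun y hy => ?_
    have hy : f y ∉ A := by simpa using hy
    set e := Finset.card {w | G.Adj y w ∧ f w ∉ A} + 1 with he
    have h1 := card_add_card_le_of_solo hk (hdeg y) (hA y hy) hTA
    rw [← he] at h1
    have h2 := card_nbrs_outside_add_le (Finset.Subset.refl A) (hA y hy)
    have h3 : e ≤ q := by have := hdeg y; omega
    have hσ : ∀ z, Solo G f z y ∧ f z ∈ T → σ z ≤ e ∧ 0 < σ z := by
      rintro z ⟨hz, hzT⟩
      refine ⟨?_, Finset.card_pos.2 ⟨y, by simp [hz, hy]⟩⟩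
      refine (Finset.card_le_card (t := insert y ({w | G.Adj y w ∧ f w ∉ A} : Finset V)) ?_).trans
        (Finset.card_insert_le _ _)
      intro y' hy'
      simp only [Finset.mem_filter, Finset.mem_univ, true_and, Finset.mem_insert] at hy' ⊢
      by_cases hyy : y' = y
      · exact .inl hyy
      · exact .inr ⟨hsolo z y y' hzT hy hy'.2 hz hy'.1 hyy, hy'.2⟩
    have he0 : (0 : ℚ) < e := by positivity
    calc (T.card : ℚ) ≤ Finset.card {z | Solo G f z y ∧ f z ∈ T} * ((q : ℚ) / e) := by
          rw [← mul_div_assoc, le_div_iff₀ he0]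
          have h1' : (T.card : ℚ) + e ≤ Finset.card {z | Solo G f z y ∧ f z ∈ T} + q := by
            exact_mod_cast h1
          have h3' : (e : ℚ) ≤ q := by exact_mod_cast h3
          have hcon' : (q : ℚ) ≤ T.card := by exact_mod_cast hcon
          nlinarith [mul_nonneg (sub_nonneg.2 hcon') (sub_nonneg.2 h3'),
            mul_le_mul_of_nonneg_right h1' (Nat.cast_nonneg (α := ℚ) q)]
      _ ≤ ∑ z with Solo G f z y ∧ f z ∈ T, (q : ℚ) / σ z := by
          rw [← nsmul_eq_mul]
          refine Finset.card_nsmul_le_sum _ _ _ fun z hz => ?_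
          obtain ⟨h4, h5⟩ := hσ z (by simpa using hz)
          have h5' : (0 : ℚ) < σ z := by exact_mod_cast h5
          have h4' : (σ z : ℚ) ≤ e := by exact_mod_cast h4
          gcongr
  have hup : ∑ y with f y ∉ A, ∑ z with Solo G f z y ∧ f z ∈ T, (q : ℚ) / σ z ≤
      (T.card * s : ℕ) * q := by
    rw [Finset.sum_comm' (t' := ({z | f z ∈ T} : Finset V))
      (s' := fun z => ({y | Solo G f z y ∧ f y ∉ A} : Finset V))
      (by intro y z; simp only [Finset.mem_filter, Finset.mem_univ, true_and]; tauto),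
      ← hTs, ← nsmul_eq_mul]
    refine Finset.sum_le_card_nsmul _ _ _ fun z _ => ?_
    rw [Finset.sum_const, nsmul_eq_mul]
    rw [mul_div_left_comm]
    exact mul_le_of_le_one_right (Nat.cast_nonneg q) (div_self_le_one _)
  have h := hlow.trans hup
  have hT0 := hTne.card_pos
  have h' : Finset.card {y | f y ∉ A} * T.card ≤ T.card * s * q := by exact_mod_cast h
  nlinarith

end Counting

section Recolouring

open scoped Classical

variable {V C : Type*} {G : SimpleGraph V} {f g : V → C} {S : Finset V} {A : Finset C}

lemma isProper_ite (hg : ∀ u ∈ S, ∀ v ∈ S, G.Adj u v → g u ≠ g v)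
    (hf : ∀ u ∉ S, ∀ v ∉ S, G.Adj u v → f u ≠ f v) (hgA : ∀ v ∈ S, g v ∉ A)
    (hfA : ∀ v ∉ S, f v ∈ A) : IsProper G (fun v => if v ∈ S then g v else f v) := by
  intro u v huv
  by_cases hu : u ∈ S <;> by_cases hv : v ∈ S <;> simp only [hu, hv, if_true, if_false]
  · exact hg u hu v hv huv
  · exact fun h => hgA u hu (h ▸ hfA v hv)
  · exact fun h => hgA v hv (h ▸ hfA u hu)
  · exact hf u hu v hv huv

variable [Fintype V]

lemma classCard_ite_of_notMem {c : C} (hfA : ∀ v ∉ S, f v ∈ A) (hc : c ∉ A) :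
    classCard (fun v => if v ∈ S then g v else f v) c = Finset.card {v ∈ S | g v = c} := by
  rw [classCard]
  congr 1
  ext v
  by_cases hv : v ∈ S
  · simp [hv]
  · simp only [Finset.mem_filter, Finset.mem_univ, true_and, hv, if_false, false_and, iff_false]
    exact fun h => hc (h ▸ hfA v hv)

lemma classCard_ite_of_mem {c : C} (hgA : ∀ v ∈ S, g v ∉ A) (hfA : ∀ v ∈ S, f v ∉ A)
    (hc : c ∈ A) : classCard (fun v => if v ∈ S then g v else f v) c = classCard f c := by
  rw [classCard, classCard]
  congr 1
  ext v
  by_cases hv : v ∈ S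
  · simp only [Finset.mem_filter, Finset.mem_univ, true_and, hv, if_true]
    exact ⟨fun h => absurd hc (h ▸ hgA v hv), fun h => absurd hc (h ▸ hfA v hv)⟩
  · simp [hv]

variable [Fintype C]

/-- The classes that can reach `a` contain more than one class. -/
lemma exists_accessible_ne {a : C} {q s : ℕ} (hk : A.card + q = Fintype.card C)
    (hdeg : ∀ v, Finset.card {w | G.Adj v w} < Fintype.card C) (ha : a ∈ A)
    (hA : ∀ y, f y ∉ A → ∀ c ∈ A, ∃ w, G.Adj y w ∧ f w = c)
    (hB : q * s < Finset.card {y | f y ∉ A}) (has : classCard f a ≤ s) : ∃ c ∈ A, c ≠ a := by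
  by_contra! hcon
  have hA1 : A = {a} := Finset.eq_singleton_iff_unique_mem.2 ⟨ha, hcon⟩
  have h1 : Finset.card {y | f y ∉ A} * 1 ≤
      ∑ y with f y ∉ A, Finset.card {w | G.Adj y w ∧ f w = a} := by
    rw [← smul_eq_mul]
    refine Finset.card_nsmul_le_sum _ _ _ fun y hy => Finset.card_pos.2 ?_
    obtain ⟨w, hw⟩ := hA y (by simpa using hy) a ha
    exact ⟨w, by simpa using hw⟩
  rw [sum_card_filter_comm _ _ (fun y z => G.Adj y z)] at h1
  have h2 : ∑ z with f z = a, Finset.card {y | G.Adj y z ∧ f y ∉ A} ≤ classCard f a * q := by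
    rw [classCard, ← smul_eq_mul]
    refine Finset.sum_le_card_nsmul _ _ _ fun z _ => ?_
    have h3 : Finset.card {y | G.Adj y z ∧ f y ∉ A} ≤ Finset.card {w | G.Adj z w} :=
      Finset.card_le_card (Finset.monotone_filter_right _ fun y _ h => h.1.symm)
    have h4 := hdeg z
    rw [hA1, Finset.card_singleton] at hk
    omega
  have h5 := Nat.mul_le_mul_right q has
  rw [mul_comm s q] at h5
  omega

/-- There is a solo edge which can be used to improve a nearly equitable colouring. -/
lemma exists_good_solo {q s : ℕ} {T : Finset C} {U : C} (hk : A.card + q = Fintype.card C)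
    (hdeg : ∀ v, Finset.card {w | G.Adj v w} < Fintype.card C)
    (hA : ∀ y, f y ∉ A → ∀ c ∈ A, ∃ w, G.Adj y w ∧ f w = c)
    (hB : q * s < Finset.card {y | f y ∉ A}) (hTA : T ⊆ A) (hTne : T.Nonempty) (hU : U ∈ A)
    (hUT : U ∉ T)
    (hT : ∀ x, f x ∈ T → ∀ d ∈ A, d ≠ U → d ∉ T → ∃ w, G.Adj x w ∧ f w = d)
    (hsize : ∀ c ∈ T, classCard f c = s) :
    ∃ z y, f z ∈ T ∧ f y ∉ A ∧ Solo G f z y ∧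
      ((∃ X ∈ A, X ≠ f z ∧ Movable G f z X) ∨
        ((∀ X ∈ A, X ≠ f z → ∃ w, G.Adj z w ∧ f w = X) ∧
          ∃ y', f y' ∉ A ∧ Solo G f z y' ∧ y' ≠ y ∧ ¬ G.Adj y y')) := by
  by_contra! hcon
  have hmov : ∀ z y, f z ∈ T → f y ∉ A → Solo G f z y →
      ∀ X ∈ A, X ≠ f z → ∃ w, G.Adj z w ∧ f w = X := by
    intro z y hz hy hzy X hX hXz
    have := (hcon z y hz hy hzy).1 X hX hXz
    simpa [Movable] using this
  obtain ⟨W, hW⟩ := hTne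
  have h1 := lt_card_of_solo_not_movable hk hdeg hA hB hTA hU hUT hT hW (hsize W hW)
    (by rintro z y rfl hy hzy; exact hmov z y hW hy hzy)
  have h2 := card_le_of_solo_clique hk hdeg hA hB hTA ⟨W, hW⟩ hsize
    (fun z y y' hz hy hy' hzy hzy' hne =>
      (hcon z y hz hy hzy).2 (hmov z y hz hy hzy) y' hy' hzy' hne)
  omega

/-- A colouring in which class `a` has one vertex too few and class `b` one too many can be turned
into an equitable one, provided equitable colourings exist for proper subsets of the vertices. -/
lemma exists_equitable_of_nearly {s : ℕ}
    (hdeg : ∀ v, Finset.card {w | G.Adj v w} < Fintype.card C)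
    (hsub : ∀ (S : Finset V) (T : Finset C), S.card < Fintype.card V → S.card = T.card * s →
      (∀ v ∈ S, Finset.card {w ∈ S | G.Adj v w} < T.card) →
      ∃ g : V → C, (∀ v ∈ S, g v ∈ T) ∧ (∀ u ∈ S, ∀ v ∈ S, G.Adj u v → g u ≠ g v) ∧
        ∀ c ∈ T, Finset.card {v ∈ S | g v = c} = s)
    (hf : IsProper G f) {a b : C}
    (hab : ∀ x, classCard f x + (if x = a then 1 else 0) = s + (if x = b then 1 else 0)) :
    ∃ f' : V → C, IsProper G f' ∧ ∀ c, classCard f' c = s := by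
  induction hn : (accessible (Arc G f) a)ᶜ.card using Nat.strong_induction_on generalizing f b with
  | _ n ih =>
  set A := accessible (Arc G f) a with hAdef
  have haA : a ∈ A := self_mem_accessible
  by_cases hb : b ∈ A
  · obtain ⟨f', hf', -, -, -, hcard⟩ := exists_shift hf (mem_accessible.1 hb)
    refine ⟨f', hf', fun c => ?_⟩
    have h1 := hcard c
    have h2 := hab c
    omega
  have hA : ∀ y, f y ∉ A → ∀ c ∈ A, ∃ w, G.Adj y w ∧ f w = c := by
    intro y hy c hc
    by_contra! hcon
    exact hy (mem_accessible_of_rel ⟨y, rfl, hcon⟩ hc)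
  have hk : A.card + n = Fintype.card C := hn ▸ Finset.card_add_card_compl A
  have hB : Finset.card {y | f y ∉ A} = n * s + 1 := by
    have h1 := card_filter_mem f (fun _ => True) Aᶜ
    simp only [true_and, Finset.mem_compl] at h1
    rw [h1]
    have h2 : ∀ c ∈ Aᶜ, Finset.card {w | f w = c} = s + (if c = b then 1 else 0) := by
      intro c hc
      have hca : c ≠ a := by rintro rfl; exact Finset.mem_compl.1 hc haA
      have := hab c
      rw [if_neg hca] at this
      exact this
    rw [Finset.sum_congr rfl h2, Finset.sum_add_distrib, Finset.sum_const, hn,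
      Finset.sum_ite_eq', if_pos (Finset.mem_compl.2 hb), smul_eq_mul]
  have hBlt : n * s < Finset.card {y | f y ∉ A} := by omega
  have hsize : ∀ c ∈ A, c ≠ a → classCard f c = s := by
    intro c hc hca
    have hcb : c ≠ b := by rintro rfl; exact hb hc
    have := hab c
    rwa [if_neg hca, if_neg hcb] at this
  obtain ⟨c₀, hc₀, hc₀a⟩ := exists_accessible_ne hk hdeg haA hA hBlt (by
    have := hab a
    have hne : a ≠ b := by rintro rfl; exact hb haA
    rw [if_pos rfl, if_neg hne] at this
    omega)
  obtain ⟨U, hU, T, hTA, hTne, hUT, haT, hTarc, hterm⟩ := exists_terminal hc₀ hc₀a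
  obtain ⟨z, y, hz, hy, hzy, hcase⟩ := exists_good_solo hk hdeg hA hBlt hTA hTne hU hUT
    (fun x hx d hd hdU hdT => by
      by_contra! hcon
      exact hTarc (f x) hx d hd hdU hdT ⟨x, rfl, hcon⟩)
    (fun c hc => hsize c (hTA hc) (by rintro rfl; exact haT hc))
  have hzA : f z ∈ A := hTA hz
  have hza : f z ≠ a := by intro h; exact haT (h ▸ hz)
  have hyz : y ≠ z := hzy.1.ne
  set S : Finset V := Finset.erase {v | f v ∉ A} y with hS
  have hmemS : ∀ v, v ∈ S ↔ v ≠ y ∧ f v ∉ A := by intro v; simp [hS]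
  have hScard : S.card + 1 = n * s + 1 := by
    rw [hS, Finset.card_erase_add_one (by simpa using hy), hB]
  obtain ⟨g, hgA, hgp, hgs⟩ := hsub S Aᶜ
    (Finset.card_lt_univ_of_notMem (x := y) (by simp [hmemS])) (by rw [hn]; omega) (by
      intro v hv
      have h1 := card_nbrs_outside_add_le (Finset.Subset.refl A) (hA v ((hmemS v).1 hv).2)
      have h2 := hdeg v
      have h3 : Finset.card {w ∈ S | G.Adj v w} ≤ Finset.card {w | G.Adj v w ∧ f w ∉ A} := by
        refine Finset.card_le_card fun w hw => ?_
        simp only [Finset.mem_filter, hmemS, Finset.mem_univ, true_and] at hw ⊢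
        exact ⟨hw.2, hw.1.2⟩
      omega)
  have hgA' : ∀ v ∈ S, g v ∉ A := fun v hv => Finset.mem_compl.1 (hgA v hv)
  rcases hcase with ⟨X, hX, hXz, hzX⟩ | ⟨hzmov, y', hy', hzy', hy'y, hyy'⟩
  · obtain ⟨f₁, hf₁, hfix, hmaps, hfX, hcard⟩ := exists_shift hf (hterm (f z) hz X hX hXz)
    have hf₁z : f₁ z = f z := hfix z (by simp)
    have hf₁y : f₁ y = f y := hfix y fun h => hy (Finset.mem_of_mem_erase h)
    have hW : ∀ w, f₁ w = f z → f w = f z := by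
      intro w hw
      by_cases hwD : f w ∈ A.erase (f z)
      · exact absurd (hw ▸ hmaps w hwD) (Finset.notMem_erase _ _)
      · rw [← hfix w hwD, hw]
    set f₂ := Function.update f₁ z X with hf₂
    have hf₂y : f₂ y = f y := by rw [hf₂, Function.update_of_ne hyz, hf₁y]
    have hf₂p : IsProper G f₂ := hf₁.update fun w hw hwX => hzX w hw (hfX w hwX)
    set f₃ := Function.update f₂ y (f z) with hf₃
    have hf₃p : IsProper G f₃ := by
      refine hf₂p.update fun w hw hwz => ?_
      by_cases hwz' : w = z
      · subst hwz'
        rw [hf₂, Function.update_self] at hwz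
        exact hXz hwz
      · rw [hf₂, Function.update_of_ne hwz'] at hwz
        exact hwz' (hzy.2 w hw (hW w hwz))
    have hf₃S : ∀ v ∈ S, f₃ v ∉ A := by
      intro v hv
      obtain ⟨h1, h2⟩ := (hmemS v).1 hv
      have hvz : v ≠ z := by rintro rfl; exact h2 hzA
      rw [hf₃, Function.update_of_ne h1, hf₂, Function.update_of_ne hvz,
        hfix v fun h => h2 (Finset.mem_of_mem_erase h)]
      exact h2
    have hf₃S' : ∀ v ∉ S, f₃ v ∈ A := by
      intro v hv
      by_cases hvy : v = y
      · subst hvy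
        rw [hf₃, Function.update_self]
        exact hzA
      by_cases hvz : v = z
      · subst hvz
        rw [hf₃, Function.update_of_ne hvy, hf₂, Function.update_self]
        exact hX
      rw [hf₃, Function.update_of_ne hvy, hf₂, Function.update_of_ne hvz]
      have hvA : f v ∈ A := by
        by_contra h
        exact hv ((hmemS v).2 ⟨hvy, h⟩)
      by_cases hvW : f v = f z
      · rw [hfix v (by simp [hvW])]
        exact hvA
      · exact Finset.mem_of_mem_erase (hmaps v (Finset.mem_erase.2 ⟨hvW, hvA⟩))
    refine ⟨_, isProper_ite hgp (fun u _ v _ => hf₃p u v) hgA' hf₃S', fun c => ?_⟩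
    by_cases hc : c ∈ A
    · rw [classCard_ite_of_mem hgA' hf₃S hc]
      have h1 := classCard_update f₂ y (f z) c
      have h2 := classCard_update f₁ z X c
      have h3 := hcard c
      have h4 := hab c
      have hcy : c ≠ f y := by rintro rfl; exact hy hc
      have hcb : c ≠ b := by rintro rfl; exact hb hc
      rw [← hf₃, hf₂y, if_neg hcy] at h1
      rw [← hf₂, hf₁z] at h2
      rw [if_neg hcb] at h4
      omega
    · rw [classCard_ite_of_notMem hf₃S' hc]
      exact hgs c (Finset.mem_compl.2 hc)
  · obtain ⟨Y, hYA, hY⟩ : ∃ Y ∈ Aᶜ, ∀ w ∈ S, G.Adj z w → g w ≠ Y := by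
      by_contra! hcon
      have h1 : Aᶜ.card ≤ Finset.card {w ∈ S | G.Adj z w} := by
        refine Finset.card_le_card_of_surjOn g fun Y hYA => ?_
        obtain ⟨w, hw, hzw, hwY⟩ := hcon Y hYA
        exact ⟨w, by simp [hw, hzw], hwY⟩
      have h2 : Finset.card {w ∈ S | G.Adj z w} < Finset.card {w | G.Adj z w ∧ f w ∉ A} := by
        refine Finset.card_lt_card (Finset.ssubset_iff_of_subset (fun w hw => ?_) |>.2
          ⟨y, by simp [hy, hzy.1.symm], by simp [hmemS]⟩)
        simp only [Finset.mem_filter, hmemS, Finset.mem_univ, true_and] at hw ⊢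
        exact ⟨hw.2, hw.1.2⟩
      have h3 := card_nbrs_outside_add_le (G := G) (f := f) (v := z)
        (Finset.erase_subset (f z) A)
        fun c hc => hzmov c (Finset.mem_of_mem_erase hc) (Finset.ne_of_mem_erase hc)
      have h4 := Finset.card_erase_add_one hzA
      have h5 := hdeg z
      omega
    have hYA' : Y ∉ A := Finset.mem_compl.1 hYA
    have hzS : z ∉ S := fun h => ((hmemS z).1 h).2 hzA
    set g₁ := Function.update g z Y with hg₁
    set f₁ := Function.update (Function.update f z Y) y (f z) with hf₁
    set S₁ := insert z S with hS₁
    have hf₁y : f₁ y = f z := by rw [hf₁, Function.update_self]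
    have hf₁z : f₁ z = Y := by rw [hf₁, Function.update_of_ne hyz.symm, Function.update_self]
    have hf₁v : ∀ v, v ≠ y → v ≠ z → f₁ v = f v := by
      intro v hvy hvz
      rw [hf₁, Function.update_of_ne hvy, Function.update_of_ne hvz]
    have hg₁z : g₁ z = Y := by rw [hg₁, Function.update_self]
    have hg₁v : ∀ v ∈ S, g₁ v = g v := by
      intro v hv
      rw [hg₁, Function.update_of_ne (by rintro rfl; exact hzS hv)]
    have hnS₁ : ∀ v ∉ S₁, v ≠ z ∧ (v ≠ y → f v ∈ A) := by
      intro v hv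
      rw [hS₁, Finset.mem_insert, not_or, hmemS] at hv
      refine ⟨hv.1, fun hvy => ?_⟩
      by_contra h
      exact hv.2 ⟨hvy, h⟩
    have hg₁A : ∀ v ∈ S₁, g₁ v ∉ A := by
      intro v hv
      rcases Finset.mem_insert.1 hv with rfl | hv
      · rwa [hg₁z]
      · rw [hg₁v v hv]
        exact hgA' v hv
    have hf₁S : ∀ v ∈ S₁, f₁ v ∉ A := by
      intro v hv
      rcases Finset.mem_insert.1 hv with rfl | hvS
      · rwa [hf₁z]
      · have hvz : v ≠ z := by rintro rfl; exact hzS hvS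
        rw [hf₁v v ((hmemS v).1 hvS).1 hvz]
        exact ((hmemS v).1 hvS).2
    have hf₁S' : ∀ v ∉ S₁, f₁ v ∈ A := by
      intro v hv
      obtain ⟨h1, h2⟩ := hnS₁ v hv
      by_cases hvy : v = y
      · rw [hvy, hf₁y]
        exact hzA
      · rw [hf₁v v hvy h1]
        exact h2 hvy
    have hyadj : ∀ w ∉ S₁, G.Adj y w → f₁ w ≠ f z := by
      intro w hw hyw hwz
      obtain ⟨h1, -⟩ := hnS₁ w hw
      rw [hf₁v w hyw.ne.symm h1] at hwz
      exact h1 (hzy.2 w hyw hwz)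
    set h : V → C := fun v => if v ∈ S₁ then g₁ v else f₁ v with hh
    have hhS : ∀ v ∈ S₁, h v = g₁ v := fun v hv => if_pos hv
    have hhS' : ∀ v ∉ S₁, h v = f₁ v := fun v hv => if_neg hv
    have hp : IsProper G h := by
      refine isProper_ite ?_ ?_ hg₁A hf₁S'
      · intro u hu v hv huv
        rcases Finset.mem_insert.1 hu with rfl | huS <;> rcases Finset.mem_insert.1 hv with rfl | hvS
        · exact absurd rfl huv.ne
        · rw [hg₁z, hg₁v v hvS]
          exact (hY v hvS huv).symm
        · rw [hg₁z, hg₁v u huS]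
          exact hY u huS huv.symm
        · rw [hg₁v u huS, hg₁v v hvS]
          exact hgp u huS v hvS huv
      · intro u hu v hv huv
        by_cases huy : u = y
        · subst huy
          rw [hf₁y]
          exact (hyadj v hv huv).symm
        · by_cases hvy : v = y
          · subst hvy
            rw [hf₁y]
            exact hyadj u hu huv.symm
          · rw [hf₁v u huy (hnS₁ u hu).1, hf₁v v hvy (hnS₁ v hv).1]
            exact hf u v huv
    have hnear : ∀ x, classCard h x + (if x = a then 1 else 0) = s + (if x = Y then 1 else 0) := by
      intro c
      by_cases hc : c ∈ A
      · have hcY : c ≠ Y := by rintro rfl; exact hYA' hc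
        have hcy : c ≠ f y := by rintro rfl; exact hy hc
        have hcb : c ≠ b := by rintro rfl; exact hb hc
        rw [hh, classCard_ite_of_mem hg₁A hf₁S hc]
        have h1 := classCard_update (Function.update f z Y) y (f z) c
        have h2 := classCard_update f z Y c
        have h3 := hab c
        rw [← hf₁, Function.update_of_ne hyz, if_neg hcy] at h1
        rw [if_neg hcY] at h2 ⊢
        rw [if_neg hcb] at h3
        omega
      · have hca : c ≠ a := by rintro rfl; exact hc haA
        rw [hh, classCard_ite_of_notMem hf₁S' hc, if_neg hca, hS₁, Finset.filter_insert, hg₁z,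
          Finset.filter_congr (q := fun v => g v = c) fun v hv => by rw [hg₁v v hv]]
        have h1 := hgs c (Finset.mem_compl.2 hc)
        by_cases hcY : c = Y
        · rw [if_pos hcY.symm, if_pos hcY, Finset.card_insert_of_notMem (by simp [hzS]), h1]
        · rw [if_neg (Ne.symm hcY), if_neg hcY, h1]
    have hiff : ∀ v, ∀ c ∈ A, c ≠ f z → (h v = c ↔ f v = c) := by
      intro v c hc hcz
      by_cases hv : v ∈ S₁
      · rw [hhS v hv]
        refine ⟨fun h' => absurd hc (h' ▸ hg₁A v hv), fun h' => ?_⟩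
        rcases Finset.mem_insert.1 hv with rfl | hv
        · exact absurd h'.symm hcz
        · exact absurd hc (h' ▸ ((hmemS v).1 hv).2)
      · rw [hhS' v hv]
        by_cases hvy : v = y
        · subst hvy
          rw [hf₁y]
          exact ⟨fun h' => absurd h'.symm hcz, fun h' => absurd hc (h' ▸ hy)⟩
        · rw [hf₁v v hvy (hnS₁ v hv).1]
    have hmovable : ∀ v, ∀ c ∈ A, c ≠ f z → Movable G f v c → Movable G h v c :=
      fun v c hc hcz hv w hw hwc => hv w hw ((hiff w c hc hcz).1 hwc)
    have hreach : ∀ c, Reaches (Arc G f) a (A.erase (f z)) c → c ∈ accessible (Arc G h) a := by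
      intro c hc
      refine mem_accessible.2 (hc.mono (Finset.subset_univ _) ?_)
      rintro x hx x' hx' ⟨v, hv, hvx'⟩
      rw [Finset.mem_erase] at hx hx'
      exact ⟨v, (hiff v x hx.2 hx.1).2 hv, hmovable v x' hx'.2 hx'.1 hvx'⟩
    have hWacc : f z ∈ accessible (Arc G h) a := by
      obtain ⟨d, ⟨w, hw, hwd⟩, hd⟩ := (reaches_accessible hzA).exists_erase hza
      obtain ⟨hdz, hdA⟩ := Finset.mem_erase.1 hd.mem
      refine mem_accessible_of_rel ⟨w, ?_, hmovable w d hdA hdz hwd⟩ (hreach d hd)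
      have hwz : w ≠ z := by
        rintro rfl
        obtain ⟨x, hx, hxd⟩ := hzmov d hdA hdz
        exact hwd x hx hxd
      have hwy : w ≠ y := by rintro rfl; exact hy (hw ▸ hzA)
      have hwS : w ∉ S₁ := by
        rw [hS₁, Finset.mem_insert, hmemS]
        rintro (h' | h')
        · exact hwz h'
        · exact h'.2 (hw ▸ hzA)
      rw [hhS' w hwS, hf₁v w hwy hwz, hw]
    have hy'S : y' ∈ S := (hmemS y').2 ⟨hy'y, hy'⟩
    have hy'S₁ : y' ∈ S₁ := Finset.mem_insert_of_mem hy'S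
    have hy'acc : h y' ∈ accessible (Arc G h) a := by
      refine mem_accessible_of_rel ⟨y', rfl, fun w hw hwz => ?_⟩ hWacc
      by_cases hwS : w ∈ S₁
      · rw [hhS w hwS] at hwz
        exact hg₁A w hwS (hwz ▸ hzA)
      · have hwy : w ≠ y := by rintro rfl; exact hyy' hw.symm
        rw [hhS' w hwS, hf₁v w hwy (hnS₁ w hwS).1] at hwz
        exact (hnS₁ w hwS).1 (hzy'.2 w hw hwz)
    refine ih _ ?_ hp hnear rfl
    rw [← hn]
    refine Finset.card_lt_card (Finset.compl_ssubset_compl.2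
      ((Finset.ssubset_iff_of_subset fun c hc => ?_).2 ⟨h y', hy'acc, ?_⟩))
    · by_cases hcz : c = f z
      · exact hcz ▸ hWacc
      · exact hreach c (hterm (f z) hz c hc hcz)
    · rw [hhS y' hy'S₁]
      exact hg₁A y' hy'S₁

end Recolouring

section HajnalSzemeredi

open scoped Classical

universe u v

lemma exists_classCard_eq {V : Type u} {C : Type v} [Fintype V] [Fintype C] {s : ℕ}
    (h : Fintype.card V = Fintype.card C * s) : ∃ f : V → C, ∀ c, classCard f c = s := by
  have e : V ≃ C × Fin s := Fintype.equivOfCardEq (by simp [h])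
  refine ⟨fun v => (e v).1, fun c => ?_⟩
  rw [classCard]
  refine Eq.trans ?_ (Finset.card_fin s)
  refine Finset.card_bij' (fun v _ => (e v).2) (fun j _ => e.symm (c, j)) (by simp) (by simp) ?_
    (by simp)
  intro v hv
  have hv : (e v).1 = c := by simpa using hv
  simp [← hv]

/-- Equitable colourings of an induced subgraph, phrased on the ambient vertex type. -/
lemma exists_equitable_on {V : Type u} {C : Type v} [Nonempty C] {s : ℕ}
    (G : SimpleGraph V) (S : Finset V) (T : Finset C)
    (h : ∀ G' : SimpleGraph S, (∀ v, Finset.card {w | G'.Adj v w} < T.card) →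
      ∃ f : S → T, IsProper G' f ∧ ∀ c, classCard f c = s)
    (hdeg : ∀ v ∈ S, Finset.card {w ∈ S | G.Adj v w} < T.card) :
    ∃ g : V → C, (∀ v ∈ S, g v ∈ T) ∧ (∀ u ∈ S, ∀ v ∈ S, G.Adj u v → g u ≠ g v) ∧
      ∀ c ∈ T, Finset.card {v ∈ S | g v = c} = s := by
  obtain ⟨f, hf, hcard⟩ := h (G.comap Subtype.val) (by
    intro v
    refine lt_of_le_of_lt ?_ (hdeg v v.2)
    refine Finset.card_le_card_of_injOn Subtype.val ?_ Subtype.val_injective.injOn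
    intro w hw
    simpa using hw)
  refine ⟨fun v => if hv : v ∈ S then f ⟨v, hv⟩ else Classical.arbitrary C, ?_, ?_, ?_⟩
  · intro v hv
    simp [hv]
  · intro u hu v hv huv
    simp only [hu, hv, dif_pos]
    exact fun h' => hf ⟨u, hu⟩ ⟨v, hv⟩ huv (Subtype.ext h')
  · intro c hc
    rw [← hcard ⟨c, hc⟩, classCard]
    symm
    refine Finset.card_bij (fun v _ => v.1) ?_ (fun _ _ _ _ h => Subtype.ext h) ?_
    · intro v hv
      have hv : f v = ⟨c, hc⟩ := by simpa using hv
      simp [hv]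
    · intro v hv
      obtain ⟨hvS, hv⟩ := Finset.mem_filter.1 hv
      simp only [hvS, dif_pos] at hv
      exact ⟨⟨v, hvS⟩, by simpa using Subtype.ext hv, rfl⟩

/-- The **Hajnal–Szemerédi theorem** when the number of colours divides the number of vertices. -/
theorem exists_equitable {V : Type u} {C : Type v} [Fintype V] [Fintype C] (G : SimpleGraph V)
    {s : ℕ} (hcard : Fintype.card V = Fintype.card C * s)
    (hdeg : ∀ v, Finset.card {w | G.Adj v w} < Fintype.card C) :
    ∃ f : V → C, IsProper G f ∧ ∀ c, classCard f c = s := by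
  induction hn : Fintype.card V using Nat.strong_induction_on generalizing V C with
  | _ n ih =>
  obtain ⟨R, hR⟩ : ∃ R : Finset V → SimpleGraph V,
      ∀ U u v, (R U).Adj u v ↔ G.Adj u v ∧ u ∈ U ∧ v ∈ U :=
    ⟨fun U =>
      { Adj := fun u v => G.Adj u v ∧ u ∈ U ∧ v ∈ U
        symm := ⟨fun _ _ h => ⟨h.1.symm, h.2.2, h.2.1⟩⟩
        loopless := ⟨fun _ h => h.1.ne rfl⟩ }, fun _ _ _ => Iff.rfl⟩
  have hRdeg : ∀ U v, Finset.card {w | (R U).Adj v w} < Fintype.card C := fun U v =>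
    lt_of_le_of_lt
      (Finset.card_le_card (Finset.monotone_filter_right _ fun _ _ h => ((hR _ _ _).1 h).1)) (hdeg v)
  suffices H : ∀ U, ∃ f : V → C, IsProper (R U) f ∧ ∀ c, classCard f c = s by
    obtain ⟨f, hf, hfs⟩ := H Finset.univ
    exact ⟨f, fun u v huv => hf u v ((hR _ _ _).2 ⟨huv, Finset.mem_univ _, Finset.mem_univ _⟩), hfs⟩
  intro U
  induction U using Finset.induction_on with
  | empty =>
    obtain ⟨f, hf⟩ := exists_classCard_eq hcard
    exact ⟨f, fun u v huv => absurd ((hR _ _ _).1 huv).2.1 (Finset.notMem_empty _), hf⟩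
  | insert x U hx ihU =>
    obtain ⟨f, hf, hfs⟩ := ihU
    obtain ⟨d, hd⟩ : ∃ d, Movable (R (insert x U)) f x d := by
      by_contra! hcon
      have h1 : (Finset.univ : Finset C).card ≤
          Finset.card {w | (R (insert x U)).Adj x w} := by
        refine Finset.card_le_card_of_surjOn f fun c _ => ?_
        have := hcon c
        rw [Movable] at this
        push Not at this
        obtain ⟨w, hw, hwc⟩ := this
        exact ⟨w, by simpa using hw, hwc⟩
      exact absurd (hRdeg (insert x U) x) (not_lt.2 h1)
    have : Nonempty C := ⟨d⟩
    have hf' : IsProper (R (insert x U)) (Function.update f x d) := by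
      intro u v huv
      have hne := huv.ne
      by_cases hu : u = x
      · subst hu
        rw [Function.update_self, Function.update_of_ne hne.symm]
        exact (hd v huv).symm
      · by_cases hv : v = x
        · subst hv
          rw [Function.update_self, Function.update_of_ne hne]
          exact hd u huv.symm
        · rw [Function.update_of_ne hu, Function.update_of_ne hv]
          obtain ⟨h1, h2, h3⟩ := (hR _ _ _).1 huv
          exact hf u v ((hR _ _ _).2 ⟨h1, Finset.mem_of_mem_insert_of_ne h2 hu,
            Finset.mem_of_mem_insert_of_ne h3 hv⟩)
    refine exists_equitable_of_nearly (hRdeg _) ?_ hf' (a := f x) (b := d) fun c => ?_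
    · intro S T hS hST hSdeg
      refine exists_equitable_on _ S T (fun G' hG' => ?_) hSdeg
      exact ih S.card (hn ▸ hS) G' (by simpa using hST) (by simpa using hG') (by simp)
    · rw [classCard_update, hfs]

/-- The Hajnal–Szemerédi theorem: the classes have size `s` or `s - 1`. -/
theorem exists_nearly_equitable {V : Type u} [Fintype V] (G : SimpleGraph V) {k : ℕ}
    (hdeg : ∀ v, Finset.card {w | G.Adj v w} < k) (hk : 0 < k) :
    ∃ f : V → Fin k, IsProper G f ∧ ∀ a b, classCard f a ≤ classCard f b + 1 := by
  obtain ⟨s, p, hp, hs⟩ : ∃ s p, p < k ∧ Fintype.card V + p = k * s := by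
    have h1 := Nat.div_add_mod (Fintype.card V + (k - 1)) k
    have h2 := Nat.mod_lt (Fintype.card V + (k - 1)) hk
    exact ⟨(Fintype.card V + (k - 1)) / k, k - 1 - (Fintype.card V + (k - 1)) % k, by omega,
      by omega⟩
  let G' : SimpleGraph (V ⊕ Fin p) := G ⊕g ⊤
  obtain ⟨f, hf, hfs⟩ := exists_equitable (C := Fin k) G' (s := s) (by simpa using hs) (by
    rintro (v | j)
    · refine lt_of_le_of_lt ?_ ((hdeg v).trans_eq (Fintype.card_fin k).symm)
      refine Finset.card_le_card_of_surjOn Sum.inl ?_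
      rintro (w | w) hw
      · exact ⟨w, by simpa [G'] using hw, rfl⟩
      · simp [G'] at hw
    · refine lt_of_le_of_lt (b := (Finset.univ : Finset (Fin p)).card) ?_ (by simpa using hp)
      refine Finset.card_le_card_of_surjOn Sum.inr ?_
      rintro (w | w) hw
      · simp [G'] at hw
      · exact ⟨w, by simp, rfl⟩)
  have hle : ∀ a, classCard (fun v => f (Sum.inl v)) a ≤ s ∧
      s ≤ classCard (fun v => f (Sum.inl v)) a + 1 := by
    intro a
    have h1 : classCard (fun v => f (Sum.inl v)) a + classCard (fun j => f (Sum.inr j)) a = s := by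
      rw [← hfs a, classCard, classCard, classCard, ← Finset.card_disjSum]
      congr 1
      ext (v | j) <;> simp
    have h2 : classCard (fun j => f (Sum.inr j)) a ≤ 1 := by
      refine Finset.card_le_one.2 fun i hi j hj => ?_
      simp only [Finset.mem_filter, Finset.mem_univ, true_and] at hi hj
      by_contra hij
      exact hf (Sum.inr i) (Sum.inr j) (by simpa [G'] using hij) (hi.trans hj.symm)
    omega
  refine ⟨fun v => f (Sum.inl v), fun u v huv => hf _ _ (by simpa [G'] using huv), fun a b => ?_⟩
  have := hle a
  have := hle b
  omega

end HajnalSzemeredi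

section Power

open scoped Classical

variable {V : Type*}

/-- The `i`-th power of a graph. -/
def power (H : SimpleGraph V) (i : ℕ) : SimpleGraph V where
  Adj u v := u ≠ v ∧ H.edist u v ≤ i
  symm := ⟨fun _ _ h => ⟨h.1.symm, SimpleGraph.edist_comm (G := H) ▸ h.2⟩⟩
  loopless := ⟨fun _ h => h.1 rfl⟩

/-- A vertex at distance `j + 1` from `v` has a neighbour at distance `j` from `v`. -/
lemma exists_adj_edist_eq {H : SimpleGraph V} {v w : V} {j : ℕ} (h : H.edist v w = (j + 1 : ℕ)) :
    ∃ x, H.Adj w x ∧ H.edist v x = j := by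
  obtain ⟨p, hp⟩ := SimpleGraph.exists_walk_of_edist_ne_top (G := H) (u := w) (v := v)
    (by rw [SimpleGraph.edist_comm, h]; exact ENat.natCast_ne_top _)
  rw [SimpleGraph.edist_comm, h, Nat.cast_inj] at hp
  cases p with
  | nil => simp at hp
  | @cons _ x _ hx p =>
    refine ⟨x, hx, le_antisymm ?_ ?_⟩
    · rw [SimpleGraph.edist_comm]
      refine (SimpleGraph.edist_le p).trans ?_
      rw [SimpleGraph.Walk.length_cons] at hp
      exact_mod_cast (by omega : p.length ≤ j)
    · have h1 : H.edist v w ≤ H.edist v x + H.edist x w := SimpleGraph.edist_triangle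
      rw [h, SimpleGraph.edist_eq_one_iff_adj.2 hx.symm, Nat.cast_add, Nat.cast_one] at h1
      exact (ENat.add_le_add_iff_right ENat.one_ne_top).1 h1

lemma power_zero_adj {H : SimpleGraph V} (u v : V) : ¬ (power H 0).Adj u v := by
  rintro ⟨hne, h⟩
  exact hne (by simpa using h)

variable [Fintype V]

lemma card_power_adj_le {H : SimpleGraph V} {Δ : ℕ}
    (hdeg : ∀ v, Finset.card {w | H.Adj v w} ≤ Δ) (i : ℕ) (v : V) :
    Finset.card {w | (power H i).Adj v w} ≤ Δ ^ i := by
  induction i with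
  | zero =>
    exact (Finset.card_eq_zero.2 (Finset.filter_eq_empty_iff.2
      fun w _ => power_zero_adj v w)).trans_le (Nat.zero_le _)
  | succ i ih =>
    let N : Finset V := {w | (power H i).Adj v w}
    let F : V → Finset V := fun x => {w | H.Adj x w ∧ H.edist v w = H.edist v x + 1}
    have hsub : ({w | (power H (i + 1)).Adj v w} : Finset V) ⊆
        ({w | H.Adj v w} : Finset V) ∪ N.biUnion F := by
      intro w hw
      obtain ⟨hvw, hd⟩ := (Finset.mem_filter.1 hw).2
      obtain ⟨n, hn⟩ := ENat.ne_top_iff_exists.1 (ne_top_of_le_ne_top (ENat.natCast_ne_top _) hd)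
      rw [← hn, Nat.cast_le] at hd
      cases n with
      | zero => exact absurd (SimpleGraph.edist_eq_zero_iff.1 hn.symm) hvw
      | succ j =>
        obtain ⟨x, hx, hxj⟩ := exists_adj_edist_eq hn.symm
        rw [Finset.mem_union]
        by_cases hvx : v = x
        · subst hvx
          exact .inl (by simpa using hx.symm)
        · refine .inr (Finset.mem_biUnion.2 ⟨x, ?_, ?_⟩)
          · simp only [N, Finset.mem_filter, Finset.mem_univ, true_and]
            exact ⟨hvx, hxj ▸ by exact_mod_cast (by omega : j ≤ i)⟩
          · simp only [F, Finset.mem_filter, Finset.mem_univ, true_and]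
            exact ⟨hx.symm, by rw [hxj, ← hn]; simp⟩
    have hF : ∀ x ∈ N, (F x).card ≤ Δ - 1 := by
      intro x hx
      obtain ⟨hvx, hd⟩ := (Finset.mem_filter.1 hx).2
      obtain ⟨n, hn⟩ := ENat.ne_top_iff_exists.1 (ne_top_of_le_ne_top (ENat.natCast_ne_top _) hd)
      cases n with
      | zero => exact absurd (SimpleGraph.edist_eq_zero_iff.1 hn.symm) hvx
      | succ j =>
        obtain ⟨y, hy, hyj⟩ := exists_adj_edist_eq hn.symm
        refine Nat.le_sub_one_of_lt (lt_of_lt_of_le (Finset.card_lt_card ?_) (hdeg x))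
        refine (Finset.ssubset_iff_of_subset
          (Finset.monotone_filter_right _ fun w _ h => h.1)).2 ⟨y, by simpa using hy, ?_⟩
        simp only [Finset.mem_filter, Finset.mem_univ, true_and, not_and]
        intro _ h
        rw [hyj, ← hn] at h
        have : j = j + 1 + 1 := by exact_mod_cast h
        omega
    have h1 : Finset.card {w | (power H (i + 1)).Adj v w} ≤ Δ + N.card * (Δ - 1) :=
      (Finset.card_le_card hsub).trans ((Finset.card_union_le _ _).trans
        (add_le_add (hdeg v) (Finset.card_biUnion_le_card_mul _ _ _ hF)))
    rcases Nat.eq_zero_or_pos i with rfl | hi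
    · have hN : N.card = 0 :=
        Finset.card_eq_zero.2 (Finset.filter_eq_empty_iff.2 fun w _ => power_zero_adj v w)
      simpa [hN] using h1
    · refine h1.trans ?_
      cases Δ with
      | zero => simp
      | succ D =>
        have h2 : D + 1 ≤ (D + 1) ^ i := Nat.le_self_pow hi.ne' _
        have h3 : N.card ≤ (D + 1) ^ i := ih
        rw [Nat.add_sub_cancel, pow_succ]
        nlinarith

end Power

end EquitableColoring


/-- Hajnal–Szemerédi-type equitable partition: every graph with maximum degree at most `Δ`
admits, for every `i` and every `k ≥ Δ^i + 1`, a partition of its vertex set into `k` parts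
such that distinct vertices in the same part are at distance at least `i + 1`
(unreachable vertices are at distance `⊤ ≥ i + 1`), and part sizes differ by at most one. -/
theorem hajnal_szemeredi_distance {V : Type*} [Fintype V] [DecidableEq V]
    (H : SimpleGraph V) (Δ : ℕ) (hdeg : ∀ v : V, (H.neighborSet v).ncard ≤ Δ)
    (i k : ℕ) (hk : Δ ^ i + 1 ≤ k) :
    ∃ P : Fin k → Finset V,
      (∀ a b : Fin k, a ≠ b → Disjoint (P a) (P b)) ∧
      (∀ v : V, ∃ a : Fin k, v ∈ P a) ∧
      (∀ a : Fin k, ∀ u ∈ P a, ∀ v ∈ P a, u ≠ v → ((i : ℕ∞) + 1 ≤ H.edist u v)) ∧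
      (∀ a b : Fin k, (P a).card ≤ (P b).card + 1) := by
  classical
  have hcard : ∀ v, Finset.card {w | H.Adj v w} ≤ Δ := by
    intro v
    rw [← Set.ncard_coe_finset]
    simpa [SimpleGraph.neighborSet] using hdeg v
  obtain ⟨f, hf, hfs⟩ := EquitableColoring.exists_nearly_equitable
    (EquitableColoring.power H i) (k := k)
    (fun v => by
      have := EquitableColoring.card_power_adj_le (H := H) (Δ := Δ)
        (fun v => by convert hcard v) i v
      omega)
    (by omega)
  refine ⟨fun a => {v | f v = a}, ?_, ?_, ?_, ?_⟩
  · intro a b hab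
    refine Finset.disjoint_left.2 fun v hva hvb => hab ?_
    simp only [Finset.mem_filter, Finset.mem_univ, true_and] at hva hvb
    exact hva.symm.trans hvb
  · exact fun v => ⟨f v, by simp⟩
  · intro a u hu v hv huv
    simp only [Finset.mem_filter, Finset.mem_univ, true_and] at hu hv
    by_contra hcon
    refine hf u v ⟨huv, ?_⟩ (hu.trans hv.symm)
    by_contra hlt
    exact hcon (Order.add_one_le_of_lt (not_le.1 hlt))
  · intro a b
    have hcl : ∀ c, Finset.card {v | f v = c} = EquitableColoring.classCard f c := by
      intro c
      rw [EquitableColoring.classCard]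
      congr
    simpa only [hcl] using hfs a b
end

section
/- Let d ∈ ℕ and let 0 < p' < p < 1 be reals. For every ε > 0 there exist Δ₀ ∈ ℕ and n₀ ∈ ℕ such that the following holds for all n ≥ n₀ and all Δ ≥ Δ₀: for every simple graph G on n vertices with maximum degree at most Δ, and every probability space carrying events (A_x)_{x ∈ V(G)} such that P(A_x) ≤ exp(−Δ^p) for every vertex x, and such that for every set X ⊆ V(G) of vertices at pairwise graph distance at least d in G the events {A_x : x ∈ X} are mutually independent, one has P( |{x ∈ V(G) : A_x occurs}| > exp(−Δ^{p'}) · n ) < ε. -/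
open MeasureTheory

open Filter Topology in
lemma tendsto_exp_rpow_sub_rpow {p p' : ℝ} (hp' : 0 < p') (h : p' < p) :
    Tendsto (fun x : ℝ => Real.exp (x ^ p' - x ^ p)) atTop (𝓝 0) := by
  have h₁ : Tendsto (fun x : ℝ => x ^ p' * (x ^ (p - p') + -1)) atTop atTop :=
    (tendsto_rpow_atTop hp').atTop_mul_atTop₀
      (tendsto_atTop_add_const_right _ _ (tendsto_rpow_atTop (sub_pos.2 h)))
  refine (Real.tendsto_exp_neg_atTop_nhds_zero.comp h₁).congr' ?_
  filter_upwards [eventually_gt_atTop 0] with x hx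
  have : x ^ p = x ^ p' * x ^ (p - p') := by
    rw [← Real.rpow_add hx, add_sub_cancel]
  simp only [Function.comp_apply, this]
  ring_nf

lemma ncard_setOf_mem_eq_sum_indicator {V Ω : Type*} [Fintype V] (A : V → Set Ω) (ω : Ω) :
    (({x : V | ω ∈ A x}).ncard : ENNReal) = ∑ x, (A x).indicator 1 ω := by
  classical
  simp [Set.indicator_apply, Set.ncard_eq_toFinset_card']

/-- The expected number of events that occur is the sum of their probabilities. -/
lemma lintegral_ncard_setOf_mem {V Ω : Type*} [Fintype V] [MeasurableSpace Ω] (P : Measure Ω)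
    {A : V → Set Ω} (hA : ∀ x, MeasurableSet (A x)) :
    ∫⁻ ω, (({x : V | ω ∈ A x}).ncard : ENNReal) ∂P = ∑ x, P (A x) := by
  simp_rw [ncard_setOf_mem_eq_sum_indicator]
  rw [lintegral_finsetSum _ fun x _ => measurable_one.indicator (hA x)]
  simp [hA]

/-- Markov's inequality for the number of events that occur. -/
lemma measure_lt_ncard_setOf_mem_le {V Ω : Type*} [Fintype V] [Nonempty V] [MeasurableSpace Ω]
    (P : Measure Ω) {A : V → Set Ω} (hA : ∀ x, MeasurableSet (A x)) {a b : ℝ}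
    (hb : 0 < b) (hP : ∀ x, P (A x) ≤ ENNReal.ofReal a) :
    P {ω | b * Fintype.card V < ({x : V | ω ∈ A x}).ncard} ≤ ENNReal.ofReal (a / b) := by
  have hn : (0 : ℝ) < Fintype.card V := by exact_mod_cast Fintype.card_pos
  have hmeas : AEMeasurable (fun ω => (({x : V | ω ∈ A x}).ncard : ENNReal)) P := by
    simp_rw [ncard_setOf_mem_eq_sum_indicator]
    exact (Finset.measurable_fun_sum _ fun x _ => measurable_one.indicator (hA x)).aemeasurable
  calc P {ω | b * Fintype.card V < ({x : V | ω ∈ A x}).ncard}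
      ≤ P {ω | ENNReal.ofReal (b * Fintype.card V) ≤ (({x : V | ω ∈ A x}).ncard : ENNReal)} := by
        refine measure_mono fun ω hω => ?_
        simp only [Set.mem_ofPred_eq] at hω ⊢
        rw [← ENNReal.ofReal_natCast]
        exact ENNReal.ofReal_le_ofReal hω.le
    _ ≤ (∫⁻ ω, (({x : V | ω ∈ A x}).ncard : ENNReal) ∂P) /
          ENNReal.ofReal (b * Fintype.card V) :=
        meas_ge_le_lintegral_div hmeas (ENNReal.ofReal_pos.2 (by positivity)).ne'
          ENNReal.ofReal_ne_top
    _ ≤ ENNReal.ofReal (Fintype.card V * a) / ENNReal.ofReal (b * Fintype.card V) := by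
        gcongr
        rw [lintegral_ncard_setOf_mem P hA, ENNReal.ofReal_mul hn.le, ENNReal.ofReal_natCast]
        refine (Finset.sum_le_sum fun x _ => hP x).trans_eq ?_
        simp
    _ = ENNReal.ofReal (a / b) := by
        rw [← ENNReal.ofReal_div_of_pos (by positivity)]
        congr 1
        field_simp

/-- Concentration of a number of events: if each event `A_x` (indexed by the vertices of a
graph `G` on `n` vertices with maximum degree at most `Δ`) has probability at most
`exp(-Δ^p)`, and events indexed by vertices at pairwise distance at least `d` are mutually
independent, then for `Δ` and `n` sufficiently large, with probability at least `1 - ε`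
at most `exp(-Δ^{p'}) n` of the events hold. -/
theorem concentration_of_events (d : ℕ) (p p' : ℝ) (hp'0 : 0 < p') (hp'p : p' < p)
    (hp1 : p < 1) (ε : ℝ) (hε : 0 < ε) :
    ∃ Δ₀ n₀ : ℕ, ∀ n Δ : ℕ, n₀ ≤ n → Δ₀ ≤ Δ →
      ∀ (V : Type) [Fintype V], Fintype.card V = n →
        ∀ G : SimpleGraph V, (∀ v : V, (G.neighborSet v).ncard ≤ Δ) →
          ∀ (Ω : Type) [MeasurableSpace Ω] (P : Measure Ω) [IsProbabilityMeasure P]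
            (A : V → Set Ω),
            (∀ x : V, MeasurableSet (A x)) →
            (∀ x : V, P (A x) ≤ ENNReal.ofReal (Real.exp (-(Δ : ℝ) ^ p))) →
            (∀ X : Finset V,
              (∀ x ∈ X, ∀ y ∈ X, x ≠ y → (d : ℕ∞) ≤ G.edist x y) →
              P (⋂ x ∈ X, A x) = ∏ x ∈ X, P (A x)) →
            P {ω | Real.exp (-(Δ : ℝ) ^ p') * n < ({x : V | ω ∈ A x}).ncard} <
              ENNReal.ofReal ε := by
  obtain ⟨Δ₀, hΔ₀⟩ := Filter.eventually_atTop.1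
    (((tendsto_exp_rpow_sub_rpow hp'0 hp'p).comp tendsto_natCast_atTop_atTop).eventually_lt_const hε)
  refine ⟨Δ₀, 1, fun n Δ hn hΔ V _ hV G _ Ω _ P _ A hA hP _ => ?_⟩
  subst hV
  have : Nonempty V := Fintype.card_pos_iff.1 hn
  refine (measure_lt_ncard_setOf_mem_le P hA (Real.exp_pos _) hP).trans_lt ?_
  rw [ENNReal.ofReal_lt_ofReal_iff hε, ← Real.exp_sub]
  simpa only [Function.comp_apply, neg_sub_neg] using hΔ₀ Δ hΔ
end

section
/- Let n ≥ 1 and let F be a rooted forest on vertex set [n] with exactly m connected components. Then the number of rooted trees on vertex set [n] that contain F is exactly n^{m−1}. -/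
/-- The undirected simple graph underlying a set `D` of directed edges on `Fin n`. -/
def underlyingGraph {n : ℕ} (D : Finset (Fin n × Fin n)) : SimpleGraph (Fin n) :=
  SimpleGraph.fromRel (fun u v => (u, v) ∈ D)

/-- A set `D` of directed edges on `Fin n` is a rooted forest (identified with the set of
its edges, each oriented away from the root of its component) iff it has no loops, no
antiparallel pair, every vertex has at most one incoming edge (its parent), and the
underlying undirected graph is acyclic.  The roots are exactly the vertices with no
incoming edge, and the underlying forest has `n - D.card` components. -/
def IsRootedForest {n : ℕ} (D : Finset (Fin n × Fin n)) : Prop :=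
  (∀ v : Fin n, (v, v) ∉ D) ∧
  (∀ u v : Fin n, (u, v) ∈ D → (v, u) ∉ D) ∧
  (∀ v : Fin n, ({u : Fin n | (u, v) ∈ D}).ncard ≤ 1) ∧
  (underlyingGraph D).IsAcyclic

/-- A rooted tree on `Fin n` is a rooted forest with one component, i.e. with `n - 1`
(directed) edges. -/
def IsRootedTree {n : ℕ} (D : Finset (Fin n × Fin n)) : Prop :=
  IsRootedForest D ∧ D.card + 1 = n

namespace IsRootedForest

variable {n : ℕ} {D D' : Finset (Fin n × Fin n)}

lemma adj_iff (hD : IsRootedForest D) {u v : Fin n} :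
    (underlyingGraph D).Adj u v ↔ (u, v) ∈ D ∨ (v, u) ∈ D := by
  simp only [underlyingGraph, SimpleGraph.fromRel_adj, and_iff_right_iff_imp]
  rintro h rfl
  exact hD.1 u (by simpa using h)

lemma eq_of_mem_of_mem (hD : IsRootedForest D) {u w v : Fin n}
    (hu : (u, v) ∈ D) (hw : (w, v) ∈ D) : u = w :=
  (Set.ncard_le_one (Set.toFinite _)).1 (hD.2.2.1 v) u hu w hw

lemma mono (hD : IsRootedForest D) (h : D' ⊆ D) : IsRootedForest D' := by
  refine ⟨fun v hv => hD.1 v (h hv), fun u v huv hvu => hD.2.1 u v (h huv) (h hvu), fun v => ?_,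
    hD.2.2.2.anti ?_⟩
  · exact le_trans (Set.ncard_le_ncard (fun u (hu : (u, v) ∈ D') => h hu) (Set.toFinite _)) (hD.2.2.1 v)
  · intro u v
    simp only [underlyingGraph, SimpleGraph.fromRel_adj]
    exact fun ⟨hne, huv⟩ => ⟨hne, huv.imp (h ·) (h ·)⟩

/-- Adding a directed edge `(u, v)` to a rooted forest yields a rooted forest iff `v` is a root
and lies in a component different from that of `u`. -/
lemma insert_iff (hD : IsRootedForest D) {u v : Fin n} (huv : (u, v) ∉ D) :
    IsRootedForest (insert (u, v) D) ↔
      (∀ x, (x, v) ∉ D) ∧ ¬ (underlyingGraph D).Reachable u v := by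
  have hgraph : underlyingGraph (insert (u, v) D) = underlyingGraph D ⊔ SimpleGraph.edge u v := by
    ext x y
    simp only [underlyingGraph, SimpleGraph.fromRel_adj, SimpleGraph.sup_adj,
      SimpleGraph.edge_adj, Finset.mem_insert, Prod.mk.injEq]
    tauto
  constructor
  · intro h
    refine ⟨fun x hx => ?_, fun hreach => ?_⟩
    · have := h.eq_of_mem_of_mem (Finset.mem_insert_of_mem hx) (Finset.mem_insert_self _ _)
      exact huv (this ▸ hx)
    · have hac := h.2.2.2
      rw [hgraph, SimpleGraph.isAcyclic_sup_fromEdgeSet_iff] at hac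
      rcases hac.2 hreach with rfl | hadj
      · exact h.1 u (Finset.mem_insert_self _ _)
      · rcases hD.adj_iff.1 hadj with h1 | h1
        · exact huv h1
        · exact h.2.1 u v (Finset.mem_insert_self _ _) (Finset.mem_insert_of_mem h1)
  · rintro ⟨hroot, hreach⟩
    have hne : u ≠ v := by rintro rfl; exact hreach (SimpleGraph.Reachable.refl u)
    have hvu : (v, u) ∉ D := fun h => hreach (hD.adj_iff.2 (Or.inr h)).reachable
    refine ⟨fun x hx => ?_, fun x y hxy hyx => ?_, fun x => ?_, ?_⟩
    · have := hD.1 x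
      grind
    · have := hD.2.1 x y
      grind
    · refine (Set.ncard_le_one (Set.toFinite _)).2 fun a ha b hb => ?_
      have := @hD.eq_of_mem_of_mem n D a b x
      have := hroot a
      have := hroot b
      simp only [Set.mem_ofPred_eq] at ha hb
      grind
    · rw [hgraph]
      exact hD.2.2.2.sup_edge_of_not_reachable hreach

lemma exists_mem_of_isPath (hD : IsRootedForest D) {a v : Fin n}
    (p : (underlyingGraph D).Walk a v) (hp : p.IsPath) (hnil : ¬ p.Nil)
    (ha : ∀ x, (x, a) ∈ D → x ∉ p.support) : ∃ x, (x, v) ∈ D := by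
  induction p with
  | nil => simp at hnil
  | @cons a b v hadj q ih =>
    have hab : (a, b) ∈ D := by
      refine (hD.adj_iff.1 hadj).resolve_right fun h => ha b h ?_
      simp
    rw [SimpleGraph.Walk.cons_isPath_iff] at hp
    by_cases hq : q.Nil
    · exact ⟨a, hq.eq ▸ hab⟩
    · refine ih hp.1 hq fun x hx => ?_
      rw [hD.eq_of_mem_of_mem hx hab]
      exact hp.2

lemma eq_of_reachable (hD : IsRootedForest D) {r s : Fin n} (hr : ∀ x, (x, r) ∉ D)
    (hs : ∀ x, (x, s) ∉ D) (h : (underlyingGraph D).Reachable r s) : r = s := by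
  obtain ⟨p, hp⟩ := h.exists_isPath
  by_contra hne
  obtain ⟨x, hx⟩ := hD.exists_mem_of_isPath p hp (fun hnil => hne hnil.eq)
    fun x hx => (hr x hx).elim
  exact hs x hx

lemma exists_root (hD : IsRootedForest D) (u : Fin n) :
    ∃ r, (∀ x, (x, r) ∉ D) ∧ (underlyingGraph D).Reachable u r := by
  by_contra! hno
  have key : ∀ k : ℕ, ∃ (v : Fin n) (p : (underlyingGraph D).Walk v u),
      p.IsPath ∧ p.length = k ∧ (p.Nil ∨ (v, p.snd) ∈ D) := by
    intro k
    induction k with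
    | zero => exact ⟨u, .nil, by simp⟩
    | succ k ih =>
      obtain ⟨v, p, hp, hk, hstart⟩ := ih
      obtain ⟨w, hw⟩ : ∃ w, (w, v) ∈ D := by
        by_contra! hv
        exact hno v hv p.reachable.symm
      have hadj : (underlyingGraph D).Adj w v := hD.adj_iff.2 (Or.inl hw)
      refine ⟨w, .cons hadj p, ?_, by simp [hk], Or.inr (by simpa using hw)⟩
      rw [SimpleGraph.Walk.cons_isPath_iff]
      refine ⟨hp, fun hmem => ?_⟩
      have hsnd := hD.2.2.2.eq_snd_of_adj_start hp hadj.symm hmem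
      rcases hstart with hnil | hstart
      · rw [SimpleGraph.Walk.nil_iff_support_eq] at hnil
        rw [hnil, List.mem_singleton] at hmem
        exact hadj.ne hmem
      · exact hD.2.1 w v hw (hsnd ▸ hstart)
  obtain ⟨v, p, hp, hlen, -⟩ := key n
  have := hp.length_lt
  simp [hlen] at this

open Classical in
lemma card_roots_add_card (hD : IsRootedForest D) :
    (Finset.univ.filter fun v => ∀ x, (x, v) ∉ D).card + D.card = n := by
  have himage : (Finset.univ.filter fun v => ¬ ∀ x, (x, v) ∉ D) = D.image Prod.snd := by
    ext v
    simp
  have hcard : (D.image Prod.snd).card = D.card := by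
    refine Finset.card_image_of_injOn ?_
    rintro ⟨a, b⟩ hab ⟨c, d⟩ hcd rfl
    rw [hD.eq_of_mem_of_mem hab hcd]
  rw [← hcard, ← himage, Finset.card_filter_add_card_filter_not]
  simp

open Classical in
/-- A rooted forest with `k + 1` components can be enlarged by one edge in `n * k` ways. -/
lemma card_extensions (hD : IsRootedForest D) {k : ℕ} (hk : D.card + (k + 1) = n) :
    (Finset.univ.filter fun e => e ∉ D ∧ IsRootedForest (insert e D)).card = n * k := by
  have hiff : ∀ u v : Fin n, ((u, v) ∉ D ∧ IsRootedForest (insert (u, v) D)) ↔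
      (∀ x, (x, v) ∉ D) ∧ ¬ (underlyingGraph D).Reachable u v := fun u v =>
    ⟨fun h => (hD.insert_iff h.1).1 h.2, fun h => ⟨h.1 u, (hD.insert_iff (h.1 u)).2 h⟩⟩
  rw [Finset.card_filter, Fintype.sum_prod_type]
  simp_rw [← Finset.card_filter, hiff]
  rw [Finset.sum_const_nat (m := k)]
  · simp
  intro u _
  obtain ⟨r, hr, hur⟩ := hD.exists_root u
  have herase : (Finset.univ.filter fun v => (∀ x, (x, v) ∉ D) ∧
      ¬ (underlyingGraph D).Reachable u v) =
      (Finset.univ.filter fun v => ∀ x, (x, v) ∉ D).erase r := by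
    ext v
    simp only [Finset.mem_filter, Finset.mem_univ, true_and, Finset.mem_erase]
    refine ⟨fun h => ⟨fun hv => h.2 (hv ▸ hur), h.1⟩, fun h => ⟨h.2, fun huv => h.1 ?_⟩⟩
    exact hD.eq_of_reachable h.2 hr (huv.symm.trans hur)
  rw [herase, Finset.card_erase_of_mem (by simpa using hr)]
  have := hD.card_roots_add_card
  omega

open Classical in
lemma card_rootedTrees (k : ℕ) (hD : IsRootedForest D) (hk : D.card + (k + 1) = n) :
    (Finset.univ.filter fun T => IsRootedTree T ∧ D ⊆ T).card = n ^ k := by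
  induction k generalizing D with
  | zero =>
    rw [pow_zero, Finset.card_eq_one]
    refine ⟨D, ?_⟩
    ext T
    simp only [Finset.mem_filter, Finset.mem_univ, true_and, Finset.mem_singleton]
    constructor
    · rintro ⟨⟨-, hT⟩, hDT⟩
      exact (Finset.eq_of_subset_of_card_le hDT (by omega)).symm
    · rintro rfl
      exact ⟨⟨hD, hk⟩, Finset.Subset.refl _⟩
  | succ k ih =>
    have hcount := Finset.sum_card_bipartiteAbove_eq_sum_card_bipartiteBelow
      (s := Finset.univ.filter fun T => IsRootedTree T ∧ D ⊆ T)
      (t := Finset.univ.filter fun e => e ∉ D ∧ IsRootedForest (insert e D)) (fun T e => e ∈ T)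
    rw [Finset.sum_const_nat (m := k + 1), Finset.sum_const_nat (m := n ^ k),
      hD.card_extensions hk] at hcount
    · refine Nat.eq_of_mul_eq_mul_right k.succ_pos (hcount.trans ?_)
      simp only [Nat.succ_eq_add_one]
      ring
    · intro e he
      simp only [Finset.mem_filter, Finset.mem_univ, true_and] at he
      rw [← ih he.2 (by rw [Finset.card_insert_of_notMem he.1]; omega)]
      congr 1
      ext T
      simp only [Finset.mem_bipartiteBelow, Finset.mem_filter, Finset.mem_univ, true_and,
        Finset.insert_subset_iff]
      tauto
    · intro T hT
      simp only [Finset.mem_filter, Finset.mem_univ, true_and] at hT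
      have hsdiff : Finset.bipartiteAbove (fun T e => e ∈ T)
          (Finset.univ.filter fun e => e ∉ D ∧ IsRootedForest (insert e D)) T = T \ D := by
        ext e
        simp only [Finset.mem_bipartiteAbove, Finset.mem_filter, Finset.mem_univ, true_and,
          Finset.mem_sdiff]
        exact ⟨fun h => ⟨h.2, h.1.1⟩,
          fun h => ⟨⟨h.2, hT.1.1.mono (Finset.insert_subset h.1 hT.2)⟩, h.1⟩⟩
      have := hT.1.2
      rw [hsdiff, Finset.card_sdiff_of_subset hT.2]
      omega

end IsRootedForest

/-- Moon's lemma: the number of rooted trees on `[n]` containing a given rooted forest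
with `m` components (equivalently, with `n - m` edges) is exactly `n^(m-1)`. -/
theorem count_rooted_trees_containing_forest (n m : ℕ) (hn : 1 ≤ n)
    (D : Finset (Fin n × Fin n)) (hD : IsRootedForest D) (hm : D.card + m = n) :
    Nat.card {D' : Finset (Fin n × Fin n) // IsRootedTree D' ∧ D ⊆ D'} = n ^ (m - 1) := by
  classical
  obtain ⟨r, hr, -⟩ := hD.exists_root ⟨0, hn⟩
  have hpos : 0 < (Finset.univ.filter fun v => ∀ x, (x, v) ∉ D).card :=
    Finset.card_pos.2 ⟨r, by simpa using hr⟩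
  have hroots := hD.card_roots_add_card
  obtain ⟨k, rfl⟩ : ∃ k, m = k + 1 := ⟨m - 1, by omega⟩
  rw [Nat.card_eq_fintype_card, Fintype.card_subtype, Nat.add_sub_cancel]
  exact hD.card_rootedTrees k hm
end

section
/- Let n ≥ 2, let S be a set of edges of the complete graph K_n on vertex set [n], and let T be a spanning tree of K_n chosen uniformly at random from all spanning trees of K_n. Then P( E(T) ∩ S = ∅ ) ≤ exp( −|S| / n ). -/
/-- A spanning tree of the complete graph on `Fin n`: a connected acyclic simple graph
on vertex set `Fin n`. -/
def IsSpanningTree {n : ℕ} (T : SimpleGraph (Fin n)) : Prop := T.Connected ∧ T.IsAcyclic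

namespace SimpleGraph

/-- Adding the edge `uv` to a tree creates a cycle through `u`, from which the other edge at `u`
can be removed to obtain a tree again. -/
lemma IsTree.exists_adj_isTree_deleteEdges_sup_edge {V : Type*} {T : SimpleGraph V}
    (hT : T.IsTree) {u v : V} (huv : u ≠ v) :
    ∃ w, T.Adj u w ∧ (T.deleteEdges {s(u, w)} ⊔ edge u v).IsTree := by
  obtain ⟨p, hp⟩ := hT.connected.exists_isPath u v
  cases p with
  | nil => exact absurd rfl huv
  | @cons _ w _ h q =>
    rw [Walk.cons_isPath_iff] at hp
    have hmem : s(u, w) ∉ q.edges := fun hm => hp.2 (q.fst_mem_support_of_mem_edges hm)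
    have hwv : (T.deleteEdges {s(u, w)}).Reachable w v := ⟨q.toDeleteEdge _ hmem⟩
    have huw : ¬ (T.deleteEdges {s(u, w)}).Reachable u w :=
      isBridge_iff.mp (isAcyclic_iff_forall_adj_isBridge.mp hT.isAcyclic h)
    have hnr : ¬ (T.deleteEdges {s(u, w)}).Reachable u v := fun hr => huw (hr.trans hwv.symm)
    refine ⟨w, h, ?_, (hT.isAcyclic.anti (deleteEdges_le _)).sup_edge_of_not_reachable hnr⟩
    have hle : T.deleteEdges {s(u, w)} ≤ T.deleteEdges {s(u, w)} ⊔ edge u v := le_sup_left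
    have huw' : (T.deleteEdges {s(u, w)} ⊔ edge u v).Reachable u w := by
      refine Reachable.trans (Adj.reachable ?_) (hwv.mono hle).symm
      simp [edge_adj, huv]
    have hadj : ∀ a b, T.Adj a b → (T.deleteEdges {s(u, w)} ⊔ edge u v).Reachable a b := by
      intro a b hab
      by_cases he : s(a, b) = s(u, w)
      · rcases Sym2.eq_iff.mp he with ⟨rfl, rfl⟩ | ⟨rfl, rfl⟩
        · exact huw'
        · exact huw'.symm
      · exact (Adj.reachable (by simpa [hab] using he)).mono hle
    have := hT.connected.nonempty
    refine ⟨fun a b => ?_⟩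
    obtain ⟨r⟩ := hT.connected a b
    induction r with
    | nil => exact Reachable.refl _
    | cons hab _ ih => exact (hadj _ _ hab).trans ih

/-- The set of trees on `V` that contain no edge of `S`. -/
def treesAvoiding {V : Type*} (S : Set (Sym2 V)) : Set (SimpleGraph V) :=
  {T | T.IsTree ∧ ∀ e ∈ S, e ∉ T.edgeSet}

variable {V : Type*} [Finite V] {S : Set (Sym2 V)} {u v : V}

lemma ncard_treesAvoiding_insert_le (huv : u ≠ v) (hS : s(u, v) ∉ S) :
    (treesAvoiding (insert s(u, v) S)).ncard ≤
      (treesAvoiding S \ treesAvoiding (insert s(u, v) S)).ncard * (Nat.card V - 1) := by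
  classical
  have hex : ∀ T : SimpleGraph V, ∃ w, T.IsTree →
      T.Adj u w ∧ (T.deleteEdges {s(u, w)} ⊔ edge u v).IsTree := fun T => by
    by_cases hT : T.IsTree
    · obtain ⟨w, hw⟩ := hT.exists_adj_isTree_deleteEdges_sup_edge huv
      exact ⟨w, fun _ => hw⟩
    · exact ⟨u, fun h => absurd h hT⟩
  choose f hf using hex
  have hcard : ({u}ᶜ : Set V).ncard = Nat.card V - 1 := by
    rw [Set.ncard_compl, Set.ncard_singleton]
  rw [← hcard, ← Set.ncard_prod]
  refine Set.ncard_le_ncard_of_injOn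
    (fun T => (T.deleteEdges {s(u, f T)} ⊔ edge u v, f T)) ?_ ?_ (Set.toFinite _)
  · rintro T ⟨hT, hTS⟩
    obtain ⟨hadj, htree⟩ := hf T hT
    refine ⟨⟨⟨htree, fun e he hmem => ?_⟩, fun h => ?_⟩, hadj.ne'⟩
    · simp only [edgeSet_sup, edgeSet_edge_of_ne huv, edgeSet_deleteEdges] at hmem
      rcases hmem with hmem | rfl
      · exact hTS e (Set.mem_insert_of_mem _ he) hmem.1
      · exact hS he
    · refine h.2 s(u, v) (Set.mem_insert _ _) ?_
      simp [edgeSet_edge_of_ne huv]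
  · have hrec : ∀ T ∈ treesAvoiding (insert s(u, v) S),
        (T.deleteEdges {s(u, f T)} ⊔ edge u v).edgeSet \ {s(u, v)} ∪ {s(u, f T)} = T.edgeSet := by
      rintro T ⟨hT, hTS⟩
      have hadj : s(u, f T) ∈ T.edgeSet := (hf T hT).1
      have hnot := hTS s(u, v) (Set.mem_insert _ _)
      rw [edgeSet_sup, edgeSet_edge_of_ne huv, edgeSet_deleteEdges]
      ext e
      simp only [Set.mem_union, Set.mem_sdiff, Set.mem_singleton_iff]
      grind
    intro T₁ h₁ T₂ h₂ heq
    obtain ⟨hg, hw⟩ := Prod.mk.inj heq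
    rw [← edgeSet_inj, ← hrec T₁ h₁, ← hrec T₂ h₂, hg, hw]

lemma card_mul_ncard_treesAvoiding_insert_le (huv : u ≠ v) (hS : s(u, v) ∉ S) :
    Nat.card V * (treesAvoiding (insert s(u, v) S)).ncard ≤
      (Nat.card V - 1) * (treesAvoiding S).ncard := by
  have hsub : treesAvoiding (insert s(u, v) S) ⊆ treesAvoiding S :=
    fun T hT => ⟨hT.1, fun e he => hT.2 e (Set.mem_insert_of_mem _ he)⟩
  have hle := ncard_treesAvoiding_insert_le huv hS
  rw [← Set.ncard_sdiff_add_ncard_of_subset hsub]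
  have : Nonempty V := ⟨u⟩
  obtain ⟨k, hk⟩ := Nat.exists_eq_succ_of_ne_zero (Nat.card_pos (α := V)).ne'
  rw [hk] at hle ⊢
  simp only [Nat.succ_eq_add_one, Nat.add_sub_cancel] at hle ⊢
  linarith

lemma ncard_treesAvoiding_le_exp (S : Finset (Sym2 V)) (hS : ∀ e ∈ S, ¬ e.IsDiag) :
    ((treesAvoiding (S : Set (Sym2 V))).ncard : ℝ) ≤
      Real.exp (-(S.card : ℝ) / Nat.card V) * (treesAvoiding (∅ : Set (Sym2 V))).ncard := by
  classical
  induction S using Finset.induction_on with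
  | empty => simp
  | insert e S he ih =>
    have ih := ih fun e he => hS e (Finset.mem_insert_of_mem he)
    have hdiag := hS e (Finset.mem_insert_self _ _)
    induction e with | _ u v
    have : Nonempty V := ⟨u⟩
    have hpos : (0 : ℝ) < Nat.card V := by exact_mod_cast Nat.card_pos
    have hstep := card_mul_ncard_treesAvoiding_insert_le (S := (S : Set (Sym2 V)))
      (by simpa using hdiag) (by simpa using he)
    have hstep' : (Nat.card V : ℝ) * (treesAvoiding (insert s(u, v) (S : Set (Sym2 V)))).ncard ≤
        (Nat.card V - 1) * (treesAvoiding (S : Set (Sym2 V))).ncard := by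
      rw [← Nat.cast_pred Nat.card_pos]
      exact_mod_cast hstep
    rw [Finset.coe_insert, Finset.card_insert_of_notMem he]
    calc ((treesAvoiding (insert s(u, v) (S : Set (Sym2 V)))).ncard : ℝ)
        ≤ (-1 / Nat.card V + 1) * (treesAvoiding (S : Set (Sym2 V))).ncard := by
          rw [div_add_one hpos.ne', div_mul_eq_mul_div, le_div_iff₀ hpos]
          linarith
      _ ≤ Real.exp (-1 / Nat.card V) * (treesAvoiding (S : Set (Sym2 V))).ncard := by
          gcongr
          exact Real.add_one_le_exp _
      _ ≤ Real.exp (-1 / Nat.card V) * (Real.exp (-(S.card : ℝ) / Nat.card V) *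
            (treesAvoiding (∅ : Set (Sym2 V))).ncard) := by gcongr
      _ = _ := by
          rw [← mul_assoc, ← Real.exp_add]
          congr 2
          push_cast
          ring

end SimpleGraph

/-- For a uniformly random spanning tree `T` of `K_n` and any set `S` of edges of `K_n`,
`P(E(T) ∩ S = ∅) ≤ exp(-|S|/n)`. -/
theorem uniform_spanning_tree_avoids_edge_set (n : ℕ) (hn : 2 ≤ n)
    (S : Finset (Sym2 (Fin n))) (hS : ∀ e ∈ S, ¬ e.IsDiag) :
    (Nat.card {T : SimpleGraph (Fin n) // IsSpanningTree T ∧ ∀ e ∈ S, e ∉ T.edgeSet} : ℝ) /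
      (Nat.card {T : SimpleGraph (Fin n) // IsSpanningTree T} : ℝ) ≤
      Real.exp (-(S.card : ℝ) / n) := by
  have htree : ∀ T : SimpleGraph (Fin n), IsSpanningTree T ↔ T.IsTree :=
    fun T => (SimpleGraph.isTree_iff T).symm
  have key := SimpleGraph.ncard_treesAvoiding_le_exp S hS
  rw [Nat.card_fin] at key
  refine div_le_of_le_mul₀ (Nat.cast_nonneg _) (Real.exp_nonneg _) ?_
  simpa [htree, SimpleGraph.treesAvoiding, ← Nat.card_coe_set_eq, Set.coe_ofPred] using key
end

section
/- Let n ≥ 2, let S be a set of edges of the complete graph K_n on vertex set [n] with |S| ≤ n/4, let e ∈ S, and let T be a spanning tree of K_n chosen uniformly at random from all spanning trees of K_n. Then P( E(T) ∩ S = {e} ) ≥ 1/n. -/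
namespace SimpleGraph

variable {V : Type*} {F T : SimpleGraph V} {w x y : V}

/-- `F` is a spanning forest with exactly two components, one containing `w` and the other `x`. -/
def IsTwoForest (w x : V) (F : SimpleGraph V) : Prop :=
  F.IsAcyclic ∧ ¬ F.Reachable w x ∧ ∀ v, F.Reachable v w ∨ F.Reachable v x

theorem IsTwoForest.symm (h : IsTwoForest w x F) : IsTwoForest x w F :=
  ⟨h.1, fun hr => h.2.1 hr.symm, fun v => (h.2.2 v).symm⟩

theorem isTwoForest_comm : IsTwoForest w x F ↔ IsTwoForest x w F :=
  ⟨.symm, .symm⟩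

theorem IsTwoForest.congr_right (h : IsTwoForest w x F) (hr : F.Reachable y x) :
    IsTwoForest w y F :=
  ⟨h.1, fun h' => h.2.1 (h'.trans hr), fun v => (h.2.2 v).imp_right fun h' => h'.trans hr.symm⟩

theorem IsTwoForest.ne (h : IsTwoForest w x F) : w ≠ x := by
  rintro rfl
  exact h.2.1 (.refl _)

theorem IsTwoForest.not_adj (h : IsTwoForest w x F) : ¬ F.Adj w x :=
  fun h' => h.2.1 h'.reachable

theorem IsTwoForest.isTree_sup_edge (h : IsTwoForest w x F) : (F ⊔ edge w x).IsTree := by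
  have hadj : (F ⊔ edge w x).Adj w x := Or.inr ((edge_adj ..).2 ⟨.inl ⟨rfl, rfl⟩, h.ne⟩)
  have hw (v : V) : (F ⊔ edge w x).Reachable v w := by
    rcases h.2.2 v with hv | hv
    · exact hv.mono le_sup_left
    · exact (hv.mono le_sup_left).trans hadj.symm.reachable
  have : Nonempty V := ⟨w⟩
  exact ⟨⟨fun u v => (hw u).trans (hw v).symm⟩, h.1.sup_edge_of_not_reachable h.2.1⟩

theorem deleteEdges_sup_edge (h : T.Adj w x) : T.deleteEdges {s(w, x)} ⊔ edge w x = T := by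
  ext a b
  by_cases hab : s(a, b) = s(w, x)
  · have : T.Adj a b := (T.adj_congr_of_sym2 hab).2 h
    simp [adj_edge, hab, this, this.ne]
  · simp [adj_edge, hab, Ne.symm hab]

theorem sup_edge_deleteEdges (h : ¬ F.Adj w x) : (F ⊔ edge w x).deleteEdges {s(w, x)} = F := by
  simp [deleteEdges_sup, h]

theorem IsTree.isTwoForest_deleteEdges (hT : T.IsTree) (h : T.Adj w x) :
    IsTwoForest w x (T.deleteEdges {s(w, x)}) := by
  refine ⟨hT.2.anti (deleteEdges_le _), isAcyclic_iff_forall_adj_isBridge.1 hT.2 h, fun v => ?_⟩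
  obtain ⟨p⟩ := hT.1.preconnected v w
  induction p with
  | nil => exact .inl (.refl _)
  | @cons a b c hab p ih =>
    by_cases he : s(a, b) = s(c, x)
    · rcases Sym2.eq_iff.1 he with ⟨rfl, rfl⟩ | ⟨rfl, rfl⟩
      · exact .inl (.refl _)
      · exact .inr (.refl _)
    · have hr : (T.deleteEdges {s(c, x)}).Reachable a b :=
        Adj.reachable (by simp [hab, he])
      exact (ih h).imp hr.trans hr.trans

theorem exists_adj_reachable_deleteEdges (hr : T.Reachable w x) (hne : w ≠ x) :
    ∃ y, T.Adj w y ∧ (T.deleteEdges {s(w, y)}).Reachable y x := by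
  obtain ⟨p, hp⟩ := hr.exists_isPath
  cases p with
  | nil => exact absurd rfl hne
  | @cons _ y _ h q =>
    rw [Walk.cons_isPath_iff] at hp
    refine ⟨y, h, reachable_deleteEdges_iff_exists_walk.2 ⟨q, fun he => ?_⟩⟩
    exact hp.2 (q.fst_mem_support_of_mem_edges he)

theorem IsTree.eq_of_reachable_deleteEdges {y₁ y₂ : V} (hT : T.IsTree)
    (h₁ : T.Adj w y₁) (h₂ : T.Adj w y₂)
    (hr₁ : (T.deleteEdges {s(w, y₁)}).Reachable y₁ x)
    (hr₂ : (T.deleteEdges {s(w, y₂)}).Reachable y₂ x) : y₁ = y₂ := by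
  classical
  by_contra hne
  have hb₁ := (hT.isTwoForest_deleteEdges h₁).2.1
  have hb₂ := (hT.isTwoForest_deleteEdges h₂).2.1
  obtain ⟨p⟩ := hr₁
  have hw : w ∉ p.support := fun hw => hb₁ (p.takeUntil w hw).reachable.symm
  have hr : (T.deleteEdges {s(w, y₂)}).Reachable y₁ x := by
    refine reachable_deleteEdges_iff_exists_walk.2 ⟨p.mapLe (deleteEdges_le _), fun he => ?_⟩
    rw [Walk.edges_mapLe_eq_edges] at he
    exact hw (p.fst_mem_support_of_mem_edges he)
  have ha : (T.deleteEdges {s(w, y₂)}).Adj w y₁ := by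
    simp [h₁, hne, h₁.ne.symm, h₂.ne]
  exact hb₂ (ha.reachable.trans (hr.trans hr₂.symm))

variable [Fintype V] [DecidableEq V]

open Classical in
/-- Pairs of a two-component forest separating `w` from `x`, satisfying `P`, and a vertex in the
component of `x`. -/
noncomputable def rootedTwoForests (w x : V) (P : SimpleGraph V → Prop) :
    Finset (SimpleGraph V × V) :=
  {p | (IsTwoForest w x p.1 ∧ P p.1) ∧ p.1.Reachable p.2 x}

open Classical in
theorem card_rootedTwoForests_add (w x : V) (P : SimpleGraph V → Prop) :
    (rootedTwoForests w x P).card + (rootedTwoForests x w P).card =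
      Finset.card {F : SimpleGraph V | IsTwoForest w x F ∧ P F} * Fintype.card V := by
  rw [← Finset.card_univ, ← Finset.card_product, ← Finset.card_union_of_disjoint]
  · congr 1
    ext ⟨F, v⟩
    simp only [rootedTwoForests, Finset.mem_union, Finset.mem_filter, Finset.mem_univ, true_and,
      Finset.mem_product, and_true, isTwoForest_comm (w := x)]
    rw [← and_or_left, and_iff_left_iff_imp]
    exact fun h => (h.1.2.2 v).symm
  · refine Finset.disjoint_left.2 fun p hp hp' => ?_
    simp only [rootedTwoForests, Finset.mem_filter, Finset.mem_univ, true_and] at hp hp'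
    exact hp.1.1.2.1 (hp'.2.symm.trans hp.2)

open Classical in
theorem card_isTwoForest (w x : V) (P : SimpleGraph V → Prop) :
    Finset.card {F : SimpleGraph V | IsTwoForest w x F ∧ P F} =
      Finset.card {T : SimpleGraph V |
        T.IsTree ∧ T.Adj w x ∧ P (T.deleteEdges {s(w, x)})} := by
  refine Finset.card_bij' (fun F _ => F ⊔ edge w x) (fun T _ => T.deleteEdges {s(w, x)})
    ?_ ?_ ?_ ?_
  · intro F hF
    simp only [Finset.mem_filter, Finset.mem_univ, true_and] at hF ⊢
    refine ⟨hF.1.isTree_sup_edge, Or.inr ((edge_adj ..).2 ⟨.inl ⟨rfl, rfl⟩, hF.1.ne⟩), ?_⟩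
    rw [sup_edge_deleteEdges hF.1.not_adj]
    exact hF.2
  · intro T hT
    simp only [Finset.mem_filter, Finset.mem_univ, true_and] at hT ⊢
    exact ⟨hT.1.isTwoForest_deleteEdges hT.2.1, hT.2.2⟩
  · intro F hF
    simp only [Finset.mem_filter, Finset.mem_univ, true_and] at hF
    exact sup_edge_deleteEdges hF.1.not_adj
  · intro T hT
    simp only [Finset.mem_filter, Finset.mem_univ, true_and] at hT
    exact deleteEdges_sup_edge hT.2.1

open Classical in
theorem card_rootedTwoForests_le (w x : V) (e : Sym2 V) :
    (rootedTwoForests w x (e ∈ ·.edgeSet)).card ≤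
      Finset.card {T : SimpleGraph V | T.IsTree ∧ e ∈ T.edgeSet} := by
  refine Finset.card_le_card_of_injOn (fun p => p.1 ⊔ edge w p.2) ?_ ?_
  · intro p hp
    simp only [rootedTwoForests, Finset.coe_filter, Finset.mem_univ, true_and,
      Set.mem_ofPred_eq] at hp ⊢
    exact ⟨(hp.1.1.congr_right hp.2).isTree_sup_edge, edgeSet_mono le_sup_left hp.1.2⟩
  · rintro ⟨F₁, y₁⟩ h₁ ⟨F₂, y₂⟩ h₂ heq
    simp only [rootedTwoForests, Finset.coe_filter, Finset.mem_univ, true_and,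
      Set.mem_ofPred_eq] at h₁ h₂ heq
    have hf₁ := h₁.1.1.congr_right h₁.2
    have hf₂ := h₂.1.1.congr_right h₂.2
    have hd₁ := sup_edge_deleteEdges hf₁.not_adj
    have hd₂ := sup_edge_deleteEdges hf₂.not_adj
    have ha₁ : (F₁ ⊔ edge w y₁).Adj w y₁ := Or.inr ((edge_adj ..).2 ⟨.inl ⟨rfl, rfl⟩, hf₁.ne⟩)
    have ha₂ : (F₂ ⊔ edge w y₂).Adj w y₂ := Or.inr ((edge_adj ..).2 ⟨.inl ⟨rfl, rfl⟩, hf₂.ne⟩)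
    rw [← heq] at hd₂ ha₂
    obtain rfl : y₁ = y₂ := hf₁.isTree_sup_edge.eq_of_reachable_deleteEdges (x := x) ha₁ ha₂
      (hd₁.symm ▸ h₁.2) (hd₂.symm ▸ h₂.2)
    rw [← hd₁, ← hd₂]

open Classical in
theorem card_isTree_le_card_rootedTwoForests (hne : w ≠ x) :
    Finset.card {T : SimpleGraph V | T.IsTree} ≤
      (rootedTwoForests w x fun _ => True).card := by
  refine Finset.card_le_card_of_surjOn (fun p => p.1 ⊔ edge w p.2) fun T hT => ?_
  simp only [Finset.coe_filter, Finset.mem_univ, true_and, Set.mem_ofPred_eq] at hT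
  obtain ⟨y, hy, hr⟩ := exists_adj_reachable_deleteEdges (hT.1.preconnected w x) hne
  refine ⟨(T.deleteEdges {s(w, y)}, y), ?_, deleteEdges_sup_edge hy⟩
  simp only [rootedTwoForests, Finset.coe_filter, Finset.mem_univ, true_and, Set.mem_ofPred_eq]
  exact ⟨⟨(hT.isTwoForest_deleteEdges hy).congr_right hr.symm, trivial⟩, hr⟩

open Classical in
/-- An edge of the complete graph lies in at least a fraction `2 / |V|` of the spanning trees. -/
theorem two_mul_card_isTree_le {f : Sym2 V} (hf : ¬ f.IsDiag) :
    2 * Finset.card {T : SimpleGraph V | T.IsTree} ≤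
      Finset.card {T : SimpleGraph V | T.IsTree ∧ f ∈ T.edgeSet} * Fintype.card V := by
  induction f with | _ w x
  have hne : w ≠ x := by simpa using hf
  have h := card_rootedTwoForests_add w x fun _ => True
  rw [card_isTwoForest] at h
  have h₁ := card_isTree_le_card_rootedTwoForests hne
  have h₂ := card_isTree_le_card_rootedTwoForests hne.symm
  simp only [and_true, mem_edgeSet] at h ⊢
  lia

open Classical in
/-- Among the spanning trees of the complete graph containing an edge `e`, a given further edge `f`
lies in at most a fraction `2 / |V|`. -/
theorem card_isTree_mem_mem_le {e f : Sym2 V} (hef : e ≠ f) :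
    Finset.card {T : SimpleGraph V | T.IsTree ∧ f ∈ T.edgeSet ∧ e ∈ T.edgeSet} * Fintype.card V ≤
      2 * Finset.card {T : SimpleGraph V | T.IsTree ∧ e ∈ T.edgeSet} := by
  induction f with | _ w x
  have h := card_rootedTwoForests_add w x (e ∈ ·.edgeSet)
  rw [card_isTwoForest] at h
  have h₁ := card_rootedTwoForests_le w x e
  have h₂ := card_rootedTwoForests_le x w e
  simp only [edgeSet_deleteEdges, Set.mem_sdiff, Set.mem_singleton_iff, hef, not_false_eq_true,
    and_true] at h
  simp only [mem_edgeSet]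
  lia

open Classical in
theorem card_isTree_mem_le_add_sum {S : Finset (Sym2 V)} {e : Sym2 V} (he : e ∈ S) :
    Finset.card {T : SimpleGraph V | T.IsTree ∧ e ∈ T.edgeSet} ≤
      Finset.card {T : SimpleGraph V | T.IsTree ∧ T.edgeSet ∩ (S : Set (Sym2 V)) = {e}} +
        ∑ f ∈ S.erase e,
          Finset.card {T : SimpleGraph V | T.IsTree ∧ f ∈ T.edgeSet ∧ e ∈ T.edgeSet} := by
  refine le_trans (Finset.card_le_card fun T hT => ?_)
    ((Finset.card_union_le _ _).trans (Nat.add_le_add_left Finset.card_biUnion_le _))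
  simp only [Finset.mem_filter, Finset.mem_univ, true_and, Finset.mem_union, Finset.mem_biUnion,
    Finset.mem_erase] at hT ⊢
  by_cases hex : ∃ f, (f ≠ e ∧ f ∈ S) ∧ f ∈ T.edgeSet
  · obtain ⟨f, hf, hfT⟩ := hex
    exact .inr ⟨f, hf, hT.1, hfT, hT.2⟩
  · refine .inl ⟨hT.1, Set.eq_singleton_iff_unique_mem.2 ⟨⟨hT.2, he⟩, fun f hf => ?_⟩⟩
    by_contra hne
    exact hex ⟨f, ⟨hne, hf.2⟩, hf.1⟩

end SimpleGraph

private theorem one_div_le_div_of_counts {n s N Ne M B : ℕ} (hn : 0 < n) (hN : 0 < N)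
    (hs : 4 * s ≤ n) (hlow : 2 * N ≤ Ne * n) (hunion : Ne ≤ M + B)
    (hsum : B * n ≤ (s - 1) * (2 * Ne)) : (1 : ℝ) / n ≤ (M : ℝ) / N := by
  have hB : 2 * B ≤ Ne := by
    refine Nat.le_of_mul_le_mul_right (c := n) ?_ hn
    calc 2 * B * n = 2 * (B * n) := by ring
      _ ≤ 2 * ((s - 1) * (2 * Ne)) := Nat.mul_le_mul_left _ hsum
      _ = 4 * (s - 1) * Ne := by ring
      _ ≤ n * Ne := Nat.mul_le_mul_right _ (by lia)
      _ = Ne * n := mul_comm _ _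
  rw [div_le_div_iff₀ (by positivity) (by positivity), one_mul]
  have : N ≤ M * n := by nlinarith
  exact_mod_cast this

/-- For a uniformly random spanning tree `T` of `K_n`, a set `S` of edges of `K_n` with
`|S| ≤ n/4` and `e ∈ S`, `P(E(T) ∩ S = {e}) ≥ 1/n`. -/
theorem uniform_spanning_tree_unique_edge (n : ℕ) (hn : 2 ≤ n)
    (S : Finset (Sym2 (Fin n))) (hS : ∀ e ∈ S, ¬ e.IsDiag)
    (hcard : (S.card : ℝ) ≤ (n : ℝ) / 4) (e : Sym2 (Fin n)) (he : e ∈ S) :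
    (1 : ℝ) / n ≤
      (Nat.card {T : SimpleGraph (Fin n) //
          IsSpanningTree T ∧ T.edgeSet ∩ (S : Set (Sym2 (Fin n))) = {e}} : ℝ) /
        (Nat.card {T : SimpleGraph (Fin n) // IsSpanningTree T} : ℝ) := by
  classical
  have hiff (T : SimpleGraph (Fin n)) : IsSpanningTree T ↔ T.IsTree :=
    ⟨fun h => ⟨h.1, h.2⟩, fun h => ⟨h.1, h.2⟩⟩
  have hcount (p : SimpleGraph (Fin n) → Prop) [DecidablePred p] :
      Finset.card {T | p T} = Nat.card {T // p T} := by
    rw [Nat.card_eq_fintype_card, Fintype.card_subtype]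
  simp only [hiff]
  have hlow := SimpleGraph.two_mul_card_isTree_le (hS e he)
  have hunion := SimpleGraph.card_isTree_mem_le_add_sum he
  have hpair (f) (hf : f ∈ S.erase e) :=
    SimpleGraph.card_isTree_mem_mem_le (Finset.ne_of_mem_erase hf).symm
  rw [Fintype.card_fin] at hlow
  simp only [Fintype.card_fin] at hpair
  have hsum := Finset.sum_le_card_nsmul _ _ _ hpair
  rw [← Finset.sum_mul, Finset.card_erase_of_mem he, smul_eq_mul] at hsum
  have hcard' : 4 * S.card ≤ n := by
    have : (4 * S.card : ℝ) ≤ n := by linarith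
    exact_mod_cast this
  have hpos : 0 < Finset.card {T : SimpleGraph (Fin n) | T.IsTree} := by
    have : Nonempty (Fin n) := ⟨⟨0, by omega⟩⟩
    obtain ⟨T, -, hT⟩ := (SimpleGraph.connected_top (V := Fin n)).exists_isTree_le
    exact Finset.card_pos.2 ⟨T, by simpa using hT⟩
  rw [hcount fun T => T.IsTree] at hlow hpos
  rw [hcount fun T => T.IsTree ∧ T.edgeSet ∩ (S : Set (Sym2 (Fin n))) = {e}] at hunion
  exact one_div_le_div_of_counts (by lia) hpos hcard' hlow hunion hsum
end

section
/- Let n ≥ 4, let e and f be any two distinct edges of the complete graph K_n on vertex set [n], and let T be a spanning tree of K_n chosen uniformly at random from all spanning trees of K_n. Then P( {e, f} ⊆ E(T) ) ≤ 4 / n². -/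
section
variable {V : Type*}

/-- A self-map encodes a rooted forest, each vertex being sent to its parent and each root to
itself, if some height function strictly decreases along every parent edge. -/
def IsParentMap (g : V → V) : Prop := ∃ d : V → ℕ, ∀ v, g v ≠ v → d (g v) < d v

namespace IsParentMap

/-- Every vertex of a rooted forest lies below a root, reached by climbing. -/
lemma exists_root {g : V → V} (hg : IsParentMap g) (v : V) :
    ∃ r, g r = r ∧ ∃ k, g^[k] v = r := by
  obtain ⟨d, hd⟩ := hg
  induction h : d v using Nat.strong_induction_on generalizing v with
  | _ m ih =>
    by_cases hv : g v = v
    · exact ⟨v, hv, 0, rfl⟩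
    · obtain ⟨r, hr, k, hk⟩ := ih _ (h ▸ hd v hv) (g v) rfl
      exact ⟨r, hr, k + 1, hk⟩

/-- The map sending each vertex to the root of its tree. -/
lemma exists_rootMap {g : V → V} (hg : IsParentMap g) :
    ∃ ρ : V → V, (∀ v, g (ρ v) = ρ v) ∧ (∀ v, ρ (g v) = ρ v) ∧ (∀ v, g v = v → ρ v = v) ∧
      ∀ v, ∃ k, g^[k] v = ρ v := by
  choose ρ hρ k hk using hg.exists_root
  refine ⟨ρ, hρ, fun v => ?_, fun v hv => ?_, fun v => ⟨k v, hk v⟩⟩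
  · have hfix : ∀ m, g^[m] (ρ v) = ρ v := fun m => Function.iterate_fixed (hρ v) m
    have hfix' : ∀ m, g^[m] (ρ (g v)) = ρ (g v) := fun m => Function.iterate_fixed (hρ _) m
    have h1 : g^[k (g v) + 1 + k v] v = ρ v := by
      rw [Function.iterate_add_apply, hk, hfix]
    have h2 : g^[k v + (k (g v) + 1)] v = ρ (g v) := by
      rw [Function.iterate_add_apply, Function.iterate_succ_apply, hk, hfix']
    rw [← h1, ← h2, add_comm]
  · rw [← hk v, Function.iterate_fixed hv]

/-- A root may be attached below any vertex outside its own tree. -/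
lemma update [DecidableEq V] {g ρ : V → V} (hg : IsParentMap g) (hρ : ∀ v, ρ (g v) = ρ v)
    (hρ' : ∀ v, g v = v → ρ v = v) {r v : V} (hr : g r = r) (hv : ρ v ≠ r) :
    IsParentMap (Function.update g r v) := by
  obtain ⟨d, hd⟩ := hg
  refine ⟨fun x => d x + if ρ x = r then d v + 1 else 0, fun x hx => ?_⟩
  by_cases hxr : x = r
  · subst hxr
    simp only [Function.update_self, hv, hρ' _ hr, if_true, if_false]
    omega
  · simp only [Function.update_of_ne hxr, hρ] at hx ⊢
    have := hd x hx
    omega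

/-- The height in an extension does not increase while climbing. -/
lemma height_iterate_le {g h : V → V} {d : V → ℕ} (hd : ∀ v, h v ≠ v → d (h v) < d v)
    (hgh : ∀ v, g v ≠ v → h v = g v) (v : V) (k : ℕ) : d (g^[k] v) ≤ d v := by
  induction k with
  | zero => rfl
  | succ k ih =>
    rw [Function.iterate_succ_apply']
    by_cases hk : g (g^[k] v) = g^[k] v
    · rwa [hk]
    · have := hd (g^[k] v) (by rwa [hgh _ hk])
      rw [hgh _ hk] at this
      omega

end IsParentMap

open Classical in
/-- The rooted trees that extend the rooted forest `g`. -/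
noncomputable def treeExtensions [Fintype V] (g : V → V) : Finset (V → V) :=
  {h | IsParentMap h ∧ (Finset.univ.filter fun v => h v = v).card = 1 ∧
    ∀ v, g v ≠ v → h v = g v}

lemma mem_treeExtensions [Fintype V] [DecidableEq V] {g h : V → V} :
    h ∈ treeExtensions g ↔ IsParentMap h ∧ (Finset.univ.filter fun v => h v = v).card = 1 ∧
      ∀ v, g v ≠ v → h v = g v := by
  simp only [treeExtensions, Finset.mem_filter, Finset.mem_univ, true_and]
  constructor <;> rintro ⟨h1, h2, h3⟩ <;> refine ⟨h1, ?_, h3⟩ <;> convert h2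

/-- Extending a rooted forest creates no new roots. -/
lemma fixedPoints_subset_of_mem_treeExtensions [Fintype V] [DecidableEq V] {g h : V → V}
    (hh : h ∈ treeExtensions g) :
    (Finset.univ.filter fun v => h v = v) ⊆ Finset.univ.filter fun v => g v = v := by
  intro v hv
  obtain ⟨-, -, h3⟩ := mem_treeExtensions.1 hh
  simp only [Finset.mem_filter, Finset.mem_univ, true_and] at hv ⊢
  by_contra hv'
  exact hv' ((h3 v hv').symm.trans hv)

/-- A rooted forest with `k + 1` components extends to `n ^ k` rooted trees. -/
lemma card_treeExtensions [Fintype V] [DecidableEq V] (k : ℕ) (g : V → V) (hg : IsParentMap g)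
    (hk : (Finset.univ.filter fun v => g v = v).card = k + 1) :
    (treeExtensions g).card = Fintype.card V ^ k := by
  induction k generalizing g with
  | zero =>
    rw [pow_zero, Finset.card_eq_one]
    refine ⟨g, Finset.eq_singleton_iff_unique_mem.2
      ⟨mem_treeExtensions.2 ⟨hg, hk, fun _ _ => rfl⟩, fun h hh => ?_⟩⟩
    obtain ⟨-, h2, h3⟩ := mem_treeExtensions.1 hh
    have heq := Finset.eq_of_subset_of_card_le (fixedPoints_subset_of_mem_treeExtensions hh) (by omega)
    funext v
    by_cases hv : g v = v
    · have : v ∈ Finset.univ.filter fun v => h v = v := heq ▸ by simpa using hv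
      simp only [Finset.mem_filter, Finset.mem_univ, true_and] at this
      rw [this, hv]
    · exact h3 v hv
  | succ k ih =>
    obtain ⟨ρ, hρ, hρg, hρf, hρk⟩ := hg.exists_rootMap
    set R := Finset.univ.filter fun v => g v = v with hR
    have memR : ∀ v, v ∈ R ↔ g v = v := by simp [hR]
    have count_left : ∀ h ∈ treeExtensions g,
        ∑ r ∈ R, ∑ v, (if ρ v ≠ r ∧ h r = v then 1 else 0) = k + 1 := by
      intro h hh
      have hsub : _ ⊆ R := fixedPoints_subset_of_mem_treeExtensions hh
      obtain ⟨⟨d, hd⟩, h2, h3⟩ := mem_treeExtensions.1 hh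
      have key : ∀ r ∈ R, ∑ v, (if ρ v ≠ r ∧ h r = v then 1 else 0) =
          if h r = r then 0 else 1 := by
        intro r hr
        have hr' := (memR r).1 hr
        rw [Finset.sum_eq_single (h r)]
        · by_cases hhr : h r = r
          · simp [hhr, hρf r hr']
          · have : ρ (h r) ≠ r := by
              intro h4
              obtain ⟨m, hm⟩ := hρk (h r)
              have h5 := IsParentMap.height_iterate_le hd h3 (h r) m
              rw [hm, h4] at h5
              exact absurd (hd r hhr) (by omega)
            simp [hhr, this]
        · intro v _ hv
          simp [hv.symm]
        · simp
      rw [Finset.sum_congr rfl key, Finset.sum_ite, Finset.sum_const_zero, zero_add,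
        Finset.sum_const, smul_eq_mul, mul_one]
      have h6 := Finset.card_sdiff_of_subset hsub
      have h7 : R.filter (fun r => ¬ h r = r) = R \ Finset.univ.filter fun v => h v = v := by
        ext; simp
      rw [h7, h6]
      omega
    have count_right : ∀ v, ∀ r ∈ R, ∑ h ∈ treeExtensions g, (if ρ v ≠ r ∧ h r = v then 1 else 0) =
        if ρ v ≠ r then Fintype.card V ^ k else 0 := by
      intro v r hr
      have hr' := (memR r).1 hr
      by_cases hv : ρ v = r
      · simp [hv]
      have hvr : v ≠ r := fun h => hv (by rw [h, hρf r hr'])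
      simp only [ne_eq, hv, not_false_eq_true, true_and, if_true]
      rw [← Finset.card_filter, ← ih (Function.update g r v) (hg.update hρg hρf hr' hv)]
      · congr 1
        ext h
        rw [Finset.mem_filter, mem_treeExtensions, mem_treeExtensions]
        constructor
        · rintro ⟨⟨h1, h2, h3⟩, h4⟩
          refine ⟨h1, h2, fun x hx => ?_⟩
          by_cases hxr : x = r
          · subst hxr; simp [h4]
          · rw [Function.update_of_ne hxr] at hx ⊢
            exact h3 x hx
        · rintro ⟨h1, h2, h3⟩
          refine ⟨⟨h1, h2, fun x hx => ?_⟩, ?_⟩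
          · have hxr : x ≠ r := fun h => hx (h ▸ hr')
            have := h3 x
            rw [Function.update_of_ne hxr] at this
            exact this hx
          · have := h3 r
            rw [Function.update_self] at this
            exact this hvr
      · have : (Finset.univ.filter fun x => Function.update g r v x = x) = R.erase r := by
          ext x
          by_cases hxr : x = r
          · subst hxr; simp [hvr]
          · simp [hxr, hR]
        rw [this, Finset.card_erase_of_mem hr, hk, Nat.add_sub_cancel]
    have total : (treeExtensions g).card * (k + 1) =
        Fintype.card V * ((k + 1) * Fintype.card V ^ k) := by
      calc (treeExtensions g).card * (k + 1)
          = ∑ h ∈ treeExtensions g, ∑ r ∈ R, ∑ v, (if ρ v ≠ r ∧ h r = v then 1 else 0) := by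
            rw [Finset.sum_congr rfl count_left, Finset.sum_const, smul_eq_mul]
        _ = ∑ v, ∑ r ∈ R, ∑ h ∈ treeExtensions g, (if ρ v ≠ r ∧ h r = v then 1 else 0) := by
            rw [Finset.sum_comm, Finset.sum_comm' (t' := R) (s' := fun _ => Finset.univ) (by simp)]
            exact Finset.sum_congr rfl fun r _ => Finset.sum_comm
        _ = ∑ v : V, (k + 1) * Fintype.card V ^ k := by
            refine Finset.sum_congr rfl fun v _ => ?_
            rw [Finset.sum_congr rfl (count_right v), ← Finset.sum_filter, Finset.sum_const,
              smul_eq_mul, Finset.filter_ne, Finset.card_erase_of_mem ((memR _).2 (hρ v)), hk,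
              Nat.add_sub_cancel]
        _ = _ := by simp
    have : 0 < k + 1 := k.succ_pos
    refine Nat.eq_of_mul_eq_mul_right this ?_
    rw [total]
    ring

/-- The simple graph whose edges join each vertex to its parent. -/
def parentGraph (g : V → V) : SimpleGraph V := SimpleGraph.fromRel fun u v => g u = v

lemma parentGraph_adj {g : V → V} {u v : V} :
    (parentGraph g).Adj u v ↔ u ≠ v ∧ (g u = v ∨ g v = u) := SimpleGraph.fromRel_adj _ _ _

lemma IsParentMap.parentGraph_connected {g : V → V} (hg : IsParentMap g) {r : V}
    (hr : ∀ v, g v = v → v = r) : (parentGraph g).Connected := by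
  rw [SimpleGraph.connected_iff_exists_forall_reachable]
  refine ⟨r, fun v => SimpleGraph.Reachable.symm ?_⟩
  obtain ⟨d, hd⟩ := hg
  induction h : d v using Nat.strong_induction_on generalizing v with
  | _ m ih =>
    by_cases hv : g v = v
    · rw [hr v hv]
    · have hadj : (parentGraph g).Adj v (g v) := parentGraph_adj.2 ⟨Ne.symm hv, Or.inl rfl⟩
      exact hadj.reachable.trans (ih _ (h ▸ hd v hv) (g v) rfl)

lemma isTree_parentGraph [Fintype V] [DecidableEq V] {g : V → V} (hg : g ∈ treeExtensions id) :
    (parentGraph g).IsTree := by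
  obtain ⟨h1, h2, -⟩ := mem_treeExtensions.1 hg
  obtain ⟨r, hr⟩ := Finset.card_eq_one.1 h2
  have hroot : ∀ v, g v = v ↔ v = r := fun v => by
    simpa using congrArg (v ∈ ·) hr
  have hconn := h1.parentGraph_connected fun v hv => (hroot v).1 hv
  refine SimpleGraph.isTree_iff_connected_and_card.2
    ⟨hconn, le_antisymm ?_ hconn.card_vert_le_card_edgeSet_add_one⟩
  have hsub : (parentGraph g).edgeSet ⊆
      ((Finset.univ.erase r).image fun v => s(v, g v) : Finset (Sym2 V)) := by
    intro e
    induction e using Sym2.ind with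
    | _ u v =>
      rw [SimpleGraph.mem_edgeSet, parentGraph_adj]
      rintro ⟨huv, rfl | rfl⟩
      · simp only [Finset.coe_image, Set.mem_image, Finset.mem_coe, Finset.mem_erase]
        exact ⟨u, ⟨fun h => huv ((hroot u).2 h).symm, Finset.mem_univ _⟩, rfl⟩
      · simp only [Finset.coe_image, Set.mem_image, Finset.mem_coe, Finset.mem_erase]
        exact ⟨v, ⟨fun h => huv ((hroot v).2 h), Finset.mem_univ _⟩, Sym2.eq_swap⟩
  have hpos : 0 < Fintype.card V := Fintype.card_pos_iff.2 ⟨r⟩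
  have hcard := (Set.ncard_le_ncard hsub (Finset.finite_toSet _)).trans
    ((Set.ncard_coe_finset _).le.trans Finset.card_image_le)
  rw [Finset.card_erase_of_mem (Finset.mem_univ _), Finset.card_univ] at hcard
  rw [Nat.card_eq_fintype_card (α := V), Nat.card_coe_set_eq]
  omega

/-- Every tree may be rooted at any of its vertices. -/
lemma SimpleGraph.IsTree.exists_parentGraph_eq [Fintype V] [DecidableEq V] {T : SimpleGraph V}
    (hT : T.IsTree) (r : V) : ∃ g ∈ treeExtensions id, g r = r ∧ parentGraph g = T := by
  have step : ∀ v, ∃ w, (v = r → w = r) ∧ (v ≠ r → T.Adj v w ∧ T.dist w r < T.dist v r) := by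
    intro v
    by_cases hv : v = r
    · exact ⟨r, fun _ => rfl, fun h => absurd hv h⟩
    obtain ⟨p, hp⟩ := hT.connected.exists_walk_length_eq_dist v r
    cases p with
    | nil => exact absurd rfl hv
    | cons hadj q =>
      refine ⟨_, fun h => absurd h hv, fun _ => ⟨hadj, ?_⟩⟩
      rw [← hp, SimpleGraph.Walk.length_cons]
      exact Nat.lt_succ_of_le (SimpleGraph.dist_le q)
  choose g hgr hg using step
  have hroot : ∀ v, g v = v ↔ v = r := fun v =>
    ⟨fun h => by_contra fun hv => (hg v hv).1.ne h.symm, fun h => by rw [hgr v h, h]⟩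
  have hparent : IsParentMap g :=
    ⟨fun v => T.dist v r, fun v hv => (hg v fun h => hv ((hroot v).2 h)).2⟩
  refine ⟨g, mem_treeExtensions.2 ⟨hparent, ?_, fun v hv => absurd rfl hv⟩, hgr r rfl, ?_⟩
  · simp only [hroot]
    exact Finset.card_eq_one.2 ⟨r, by ext; simp⟩
  · have hle : parentGraph g ≤ T := by
      intro u v huv
      obtain ⟨hne, rfl | rfl⟩ := parentGraph_adj.1 huv
      · exact (hg u fun h => hne ((hroot u).2 h).symm).1
      · exact (hg v fun h => hne ((hroot v).2 h)).1.symm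
    exact le_antisymm hle ((SimpleGraph.isTree_iff_minimal_connected.1 hT).2
      (hparent.parentGraph_connected fun v hv => (hroot v).1 hv) hle)

/-- A rooted tree is determined by its root and its underlying graph. -/
lemma eq_of_parentGraph_eq [Fintype V] [DecidableEq V] {g h : V → V} (hg : IsParentMap g)
    {r : V} (hgr : ∀ v, g v = v ↔ v = r) (hhr : h r = r)
    (hgh : parentGraph g = parentGraph h) : h = g := by
  obtain ⟨d, hd⟩ := hg
  funext v
  induction hm : d v using Nat.strong_induction_on generalizing v with
  | _ m ih =>
    by_cases hv : g v = v
    · rw [hv, (hgr v).1 hv, hhr]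
    · have hadj : (parentGraph h).Adj v (g v) :=
        hgh ▸ parentGraph_adj.2 ⟨Ne.symm hv, Or.inl rfl⟩
      obtain ⟨-, h1 | h1⟩ := parentGraph_adj.1 hadj
      · exact h1
      · have hlt := hd v hv
        have h2 := ih _ (hm ▸ hlt) (g v) rfl
        rw [h1] at h2
        have h3 := hd (g v) fun h4 => hv (h4.symm.trans h2.symm)
        rw [← h2] at h3
        omega

/-- At most `n ^ (n - 3)` rooted trees contain two distinct edges with prescribed orientations. -/
lemma card_oriented_le [Fintype V] [DecidableEq V] {a b c d : V} (hab : a ≠ b) (hcd : c ≠ d)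
    (hne : s(a, b) ≠ s(c, d)) (hV : 3 ≤ Fintype.card V) :
    ((treeExtensions (id : V → V)).filter fun g => g a = b ∧ g c = d).card ≤
      Fintype.card V ^ (Fintype.card V - 3) := by
  rcases Finset.eq_empty_or_nonempty
    ((treeExtensions (id : V → V)).filter fun g => g a = b ∧ g c = d) with h0 | ⟨h, hh⟩
  · simp [h0]
  obtain ⟨htree, rfl, rfl⟩ := Finset.mem_filter.1 hh
  obtain ⟨⟨δ, hδ⟩, -, -⟩ := mem_treeExtensions.1 htree
  have hac : a ≠ c := fun h => hne (by rw [h])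
  set g : V → V := fun v => if v = a ∨ v = c then h v else v with hgdef
  have hg : ∀ v, g v = v ↔ v ≠ a ∧ v ≠ c := by
    intro v
    by_cases hv : v = a ∨ v = c
    · rcases hv with rfl | rfl <;> simp [hgdef, hab.symm, hcd.symm]
    · exact iff_of_true (if_neg hv) (not_or.1 hv)
  have hparent : IsParentMap g := by
    refine ⟨δ, fun v hv => ?_⟩
    have hv' : v = a ∨ v = c := by
      by_contra hv'
      simp [hgdef, hv'] at hv
    simp only [hgdef, hv', if_true] at hv ⊢
    exact hδ v hv
  have hroots : (Finset.univ.filter fun v => g v = v).card = (Fintype.card V - 3) + 1 := by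
    have : (Finset.univ.filter fun v => g v = v) = (Finset.univ.erase a).erase c := by
      ext v
      simp [hg, and_comm]
    rw [this, Finset.card_erase_of_mem (by simp [hac.symm]),
      Finset.card_erase_of_mem (by simp), Finset.card_univ]
    omega
  rw [← card_treeExtensions _ g hparent hroots]
  refine Finset.card_le_card fun k hk => ?_
  obtain ⟨hk, hka, hkc⟩ := Finset.mem_filter.1 hk
  obtain ⟨h1, h2, -⟩ := mem_treeExtensions.1 hk
  refine mem_treeExtensions.2 ⟨h1, h2, fun v hv => ?_⟩
  have hv' : v = a ∨ v = c := by
    by_contra hv'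
    simp [hgdef, hv'] at hv
  rcases hv' with rfl | rfl <;> simp [hgdef, hka, hkc]

/-- There are at least `n ^ (n - 1)` rooted trees on `n` vertices. -/
lemma card_rootedTrees_le [Fintype V] [DecidableEq V] [Nonempty V] :
    Fintype.card V ^ (Fintype.card V - 1) ≤
      Nat.card {T : SimpleGraph V // T.IsTree} * Fintype.card V := by
  have hid : IsParentMap (id : V → V) := ⟨fun _ => 0, fun v hv => absurd rfl hv⟩
  have hpos : 0 < Fintype.card V := Fintype.card_pos
  rw [← card_treeExtensions _ id hid (by simp; omega), ← Nat.card_eq_fintype_card,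
    ← Nat.card_prod, ← Nat.card_eq_finsetCard]
  have hroot : ∀ g : treeExtensions (id : V → V), ∃ r, ∀ v, g.1 v = v ↔ v = r := by
    rintro ⟨g, hg⟩
    obtain ⟨r, hr⟩ := Finset.card_eq_one.1 (mem_treeExtensions.1 hg).2.1
    exact ⟨r, fun v => by simpa using congrArg (v ∈ ·) hr⟩
  choose ρ hρ using hroot
  refine Nat.card_le_card_of_injective
    (fun g : treeExtensions (id : V → V) => (⟨⟨parentGraph g.1, isTree_parentGraph g.2⟩, ρ g⟩ :
      {T : SimpleGraph V // T.IsTree} × V)) fun g h hgh => ?_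
  obtain ⟨h1, h2⟩ := Prod.mk.inj hgh
  refine Subtype.ext (eq_of_parentGraph_eq (mem_treeExtensions.1 h.2).1 (hρ h) ?_
    (congrArg Subtype.val h1).symm)
  exact (hρ g _).2 h2.symm

/-- At most `4 * n ^ (n - 3)` rooted trees contain two given distinct edges. -/
lemma card_rootedTrees_mem_mem_le [Fintype V] [DecidableEq V] {a b c d : V} (hab : a ≠ b)
    (hcd : c ≠ d) (hne : s(a, b) ≠ s(c, d)) (hV : 3 ≤ Fintype.card V) :
    Nat.card {T : SimpleGraph V // T.IsTree ∧ s(a, b) ∈ T.edgeSet ∧ s(c, d) ∈ T.edgeSet} *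
      Fintype.card V ≤ 4 * Fintype.card V ^ (Fintype.card V - 3) := by
  set F : V → V → V → V → Finset (V → V) := fun a b c d =>
    (treeExtensions (id : V → V)).filter fun g => g a = b ∧ g c = d with hF
  have hunion : (F a b c d ∪ F a b d c ∪ (F b a c d ∪ F b a d c)).card ≤
      4 * Fintype.card V ^ (Fintype.card V - 3) := by
    have h1 := card_oriented_le hab hcd hne hV
    have h2 := card_oriented_le hab hcd.symm (by rwa [Sym2.eq_swap (a := d)]) hV
    have h3 := card_oriented_le hab.symm hcd (by rwa [Sym2.eq_swap (a := b)]) hV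
    have h4 := card_oriented_le hab.symm hcd.symm
      (by rwa [Sym2.eq_swap (a := b), Sym2.eq_swap (a := d)]) hV
    have h5 := Finset.card_union_le (F a b c d ∪ F a b d c) (F b a c d ∪ F b a d c)
    have h6 := Finset.card_union_le (F a b c d) (F a b d c)
    have h7 := Finset.card_union_le (F b a c d) (F b a d c)
    simp only [hF] at *
    omega
  refine le_trans ?_ hunion
  rw [← Nat.card_eq_fintype_card, ← Nat.card_prod, ← Nat.card_eq_finsetCard]
  choose φ hφ hφr hφT using
    fun p : {T : SimpleGraph V // T.IsTree ∧ s(a, b) ∈ T.edgeSet ∧ s(c, d) ∈ T.edgeSet} × V =>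
      p.1.2.1.exists_parentGraph_eq p.2
  refine Nat.card_le_card_of_injective (fun p => ⟨φ p, ?_⟩) fun p q hpq => ?_
  · have h1 : (parentGraph (φ p)).Adj a b := hφT p ▸ p.1.2.2.1
    have h2 : (parentGraph (φ p)).Adj c d := hφT p ▸ p.1.2.2.2
    have h3 := (parentGraph_adj.1 h1).2
    have h4 := (parentGraph_adj.1 h2).2
    simp only [hF, Finset.mem_union, Finset.mem_filter, hφ p, true_and]
    tauto
  · have heq : φ p = φ q := congrArg Subtype.val hpq
    refine Prod.ext (Subtype.ext ?_) ?_
    · rw [← hφT p, ← hφT q, heq]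
    · obtain ⟨r, hr⟩ := Finset.card_eq_one.1 (mem_treeExtensions.1 (hφ p)).2.1
      have hroot : ∀ v, φ p v = v → v = r := fun v hv => by
        simpa using hr.subset (by simpa using hv : v ∈ Finset.univ.filter fun v => φ p v = v)
      rw [hroot _ (hφr p), hroot q.2 (heq ▸ hφr q)]

end

/-- For any two distinct edges `e`, `f` of `K_n` and a uniformly random spanning tree `T`
of `K_n`, `P({e, f} ⊆ E(T)) ≤ 4/n²`. -/
theorem uniform_spanning_tree_two_edges (n : ℕ) (hn : 4 ≤ n)
    (e f : Sym2 (Fin n)) (he : ¬ e.IsDiag) (hf : ¬ f.IsDiag) (hef : e ≠ f) :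
    (Nat.card {T : SimpleGraph (Fin n) //
        IsSpanningTree T ∧ e ∈ T.edgeSet ∧ f ∈ T.edgeSet} : ℝ) /
      (Nat.card {T : SimpleGraph (Fin n) // IsSpanningTree T} : ℝ) ≤
      4 / (n : ℝ) ^ 2 := by
  obtain ⟨a, b⟩ := e
  obtain ⟨c, d⟩ := f
  have : Nonempty (Fin n) := ⟨⟨0, by omega⟩⟩
  have hcard : Fintype.card (Fin n) = n := Fintype.card_fin n
  have hup := card_rootedTrees_mem_mem_le (V := Fin n) (a := a) (b := b) (c := c) (d := d)
    he hf hef (by omega)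
  have hlow := card_rootedTrees_le (V := Fin n)
  simp only [hcard, SimpleGraph.isTree_iff] at hup hlow
  change (Nat.card {T : SimpleGraph (Fin n) // (T.Connected ∧ T.IsAcyclic) ∧
      s(a, b) ∈ T.edgeSet ∧ s(c, d) ∈ T.edgeSet} : ℝ) /
    (Nat.card {T : SimpleGraph (Fin n) // T.Connected ∧ T.IsAcyclic} : ℝ) ≤ _
  set A := Nat.card {T : SimpleGraph (Fin n) // (T.Connected ∧ T.IsAcyclic) ∧
      s(a, b) ∈ T.edgeSet ∧ s(c, d) ∈ T.edgeSet}
  set B := Nat.card {T : SimpleGraph (Fin n) // T.Connected ∧ T.IsAcyclic}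
  have hn0 : 0 < n := by omega
  have hB : 0 < B := by
    refine Nat.pos_of_ne_zero fun h => ?_
    rw [h, zero_mul] at hlow
    exact absurd hlow (Nat.pow_pos hn0).not_ge
  have key : A * n ^ 2 ≤ 4 * B := by
    refine Nat.le_of_mul_le_mul_right ?_ hn0
    calc A * n ^ 2 * n = A * n * n ^ 2 := by ring
      _ ≤ 4 * n ^ (n - 3) * n ^ 2 := Nat.mul_le_mul_right _ hup
      _ = 4 * n ^ (n - 1) := by rw [mul_assoc, ← pow_add]; congr 2; omega
      _ ≤ 4 * B * n := by rw [mul_assoc]; exact Nat.mul_le_mul_left _ hlow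
  rw [div_le_div_iff₀ (by exact_mod_cast hB) (by positivity)]
  exact_mod_cast key
end

section
/- There exists Δ₀ ∈ ℕ such that for every integer Δ ≥ Δ₀ and every real s ≥ exp(Δ^{1.03}), setting τ = √Δ · s^{−1/(3Δ)}, the following inequality holds: (e^{−τ} · τ^Δ / Δ!) · (1 − e^{−τ})^Δ ≥ s^{−2/3}. -/
open Filter Topology

/-- The arithmetic-geometric mean bound `n! ≤ ((n + 1) / 2) ^ n`, without divisions. -/
theorem two_pow_mul_factorial_le_succ_pow (n : ℕ) :
    (2 : ℝ) ^ n * n.factorial ≤ ((n : ℝ) + 1) ^ n := by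
  induction n with
  | zero => simp
  | succ n ih =>
    have hn : (0 : ℝ) < (n : ℝ) + 1 := by positivity
    have bernoulli : 2 * ((n : ℝ) + 1) ^ (n + 1) ≤ ((n : ℝ) + 1 + 1) ^ (n + 1) := by
      have h := one_add_mul_le_pow (a := 1 / ((n : ℝ) + 1))
        (by linarith [one_div_pos.mpr hn]) (n + 1)
      have two_eq : 1 + ((n + 1 : ℕ) : ℝ) * (1 / ((n : ℝ) + 1)) = 2 := by
        push_cast
        field_simp
        norm_num
      have base_eq : (n : ℝ) + 1 + 1 = (1 + 1 / ((n : ℝ) + 1)) * ((n : ℝ) + 1) := by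
        field_simp
      rw [two_eq] at h
      rw [base_eq, mul_pow]
      gcongr
    calc (2 : ℝ) ^ (n + 1) * (n + 1).factorial
        = 2 * (((n : ℝ) + 1) * (2 ^ n * n.factorial)) := by
          rw [Nat.factorial_succ]
          push_cast
          ring
      _ ≤ 2 * (((n : ℝ) + 1) * ((n : ℝ) + 1) ^ n) := by gcongr
      _ = 2 * ((n : ℝ) + 1) ^ (n + 1) := by ring
      _ ≤ (((n + 1 : ℕ) : ℝ) + 1) ^ (n + 1) := by
          push_cast
          exact bernoulli

theorem add_one_pow_le_three_mul_pow {n : ℕ} (hn : 0 < n) :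
    ((n : ℝ) + 1) ^ n ≤ 3 * (n : ℝ) ^ n := by
  have hn' : (0 : ℝ) < n := by exact_mod_cast hn
  calc ((n : ℝ) + 1) ^ n = (1 / (n : ℝ) + 1) ^ n * (n : ℝ) ^ n := by
        rw [← mul_pow]
        congr 1
        field_simp
        ring
    _ ≤ Real.exp (1 / (n : ℝ)) ^ n * (n : ℝ) ^ n := by
        gcongr
        exact Real.add_one_le_exp _
    _ = Real.exp 1 * (n : ℝ) ^ n := by
        rw [← Real.exp_nat_mul, mul_one_div_cancel hn'.ne']
    _ ≤ 3 * (n : ℝ) ^ n := by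
        gcongr
        linarith [Real.exp_one_lt_d9]

theorem two_mul_factorial_le_two_thirds_mul_pow {n : ℕ} (hn : 7 ≤ n) :
    2 * (n.factorial : ℝ) ≤ (2 / 3 : ℝ) ^ n * (n : ℝ) ^ n := by
  have six_le : (6 : ℝ) ≤ (4 / 3 : ℝ) ^ n :=
    le_trans (by norm_num) (pow_le_pow_right₀ (by norm_num : (1 : ℝ) ≤ 4 / 3) hn)
  have h : (2 : ℝ) ^ n * n.factorial ≤ 3 * (n : ℝ) ^ n :=
    (two_pow_mul_factorial_le_succ_pow n).trans (add_one_pow_le_three_mul_pow (by omega))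
  have pow_eq : (2 / 3 : ℝ) ^ n * 2 ^ n = (4 / 3 : ℝ) ^ n := by
    rw [← mul_pow]
    norm_num
  have hpos : (0 : ℝ) < (2 / 3 : ℝ) ^ n := by positivity
  have := mul_le_mul_of_nonneg_left h hpos.le
  rw [← mul_assoc, pow_eq] at this
  have := mul_le_mul_of_nonneg_right six_le (Nat.cast_nonneg (α := ℝ) n.factorial)
  linarith

theorem two_thirds_mul_le_one_sub_exp_neg {t : ℝ} (ht : 0 ≤ t) (ht' : t ≤ 1 / 2) :
    2 / 3 * t ≤ 1 - Real.exp (-t) := by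
  have h : Real.exp (-t) ≤ (t + 1)⁻¹ := by
    rw [Real.exp_neg]
    gcongr
    exact Real.add_one_le_exp t
  have hinv : (t + 1)⁻¹ ≤ 1 - 2 / 3 * t := by
    rw [inv_le_iff_one_le_mul₀ (by linarith)]
    nlinarith
  linarith

theorem tendsto_sqrt_mul_exp_neg_rpow {a c : ℝ} (ha : 0 < a) (hc : 0 < c) :
    Tendsto (fun x : ℝ => Real.sqrt x * Real.exp (-c * x ^ a)) atTop (𝓝 0) := by
  refine ((tendsto_rpow_mul_exp_neg_mul_atTop_nhds_zero (1 / (2 * a)) c hc).comp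
    (tendsto_rpow_atTop ha)).congr' ?_
  filter_upwards [eventually_ge_atTop 0] with x hx
  have exponent_eq : a * (1 / (2 * a)) = 1 / 2 := by field_simp
  simp only [Function.comp_apply]
  rw [← Real.rpow_mul hx, exponent_eq, Real.sqrt_eq_rpow]

/-- For `Δ` sufficiently large and `s ≥ exp(Δ^{1.03})`, with `τ = √Δ · s^{-1/(3Δ)}`,
one has `(e^{-τ} τ^Δ / Δ!) · (1 - e^{-τ})^Δ ≥ s^{-2/3}`. -/
theorem repair_probability_bound :
    ∃ Δ₀ : ℕ, ∀ Δ : ℕ, Δ₀ ≤ Δ → ∀ s : ℝ, Real.exp ((Δ : ℝ) ^ (1.03 : ℝ)) ≤ s →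
      ∀ τ : ℝ, τ = Real.sqrt Δ * s ^ (-(1 : ℝ) / (3 * Δ)) →
        s ^ (-(2 : ℝ) / 3) ≤
          Real.exp (-τ) * τ ^ Δ / (Nat.factorial Δ) * (1 - Real.exp (-τ)) ^ Δ := by
  have hsmall := ((tendsto_sqrt_mul_exp_neg_rpow (a := 0.03) (c := 1 / 3) (by norm_num)
    (by norm_num)).comp tendsto_natCast_atTop_atTop).eventually_le_const
      (show (0 : ℝ) < 1 / 2 by norm_num)
  obtain ⟨N, hN⟩ := eventually_atTop.mp hsmall
  refine ⟨max N 7, fun Δ hΔ s hs τ hτ => ?_⟩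
  have hΔ7 : 7 ≤ Δ := (le_max_right _ _).trans hΔ
  have hΔ0 : (0 : ℝ) < Δ := by
    have : 0 < Δ := by omega
    exact_mod_cast this
  have hs0 : 0 < s := (Real.exp_pos _).trans_le hs
  have hτ0 : 0 ≤ τ := by
    rw [hτ]
    positivity
  have hτ_half : τ ≤ 1 / 2 := by
    refine le_trans ?_ (hN Δ ((le_max_left _ _).trans hΔ))
    rw [hτ]
    simp only [Function.comp_apply]
    gcongr
    refine (Real.rpow_le_rpow_of_nonpos (Real.exp_pos _) hs ?_).trans_eq ?_
    · exact div_nonpos_of_nonpos_of_nonneg (by norm_num) (by positivity)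
    · rw [← Real.exp_mul]
      have split : (Δ : ℝ) ^ (1.03 : ℝ) = (Δ : ℝ) * (Δ : ℝ) ^ (0.03 : ℝ) := by
        rw [← Real.rpow_one_add' hΔ0.le (by norm_num)]
        norm_num
      rw [split]
      congr 1
      field_simp
  have τ_pow : τ ^ Δ * τ ^ Δ = (Δ : ℝ) ^ Δ * s ^ (-(2 : ℝ) / 3) := by
    rw [← mul_pow, hτ, mul_mul_mul_comm, Real.mul_self_sqrt hΔ0.le, mul_pow,
      ← Real.rpow_add hs0, ← Real.rpow_mul_natCast hs0.le]
    congr 2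
    field_simp
    norm_num
  have hexp : 1 / 2 ≤ Real.exp (-τ) := by linarith [Real.add_one_le_exp (-τ)]
  have hfact : (0 : ℝ) < Δ.factorial := by exact_mod_cast Δ.factorial_pos
  calc s ^ (-(2 : ℝ) / 3)
      = 2 * (Δ.factorial : ℝ) * (s ^ (-(2 : ℝ) / 3) / (2 * Δ.factorial)) := by field_simp
    _ ≤ (2 / 3 : ℝ) ^ Δ * (Δ : ℝ) ^ Δ * (s ^ (-(2 : ℝ) / 3) / (2 * Δ.factorial)) :=
        mul_le_mul_of_nonneg_right (two_mul_factorial_le_two_thirds_mul_pow hΔ7) (by positivity)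
    _ = (2 / 3 : ℝ) ^ Δ * ((Δ : ℝ) ^ Δ * s ^ (-(2 : ℝ) / 3)) / (2 * Δ.factorial) := by ring
    _ = 1 / 2 * τ ^ Δ / Δ.factorial * (2 / 3 * τ) ^ Δ := by
        rw [← τ_pow, mul_pow]
        field_simp
    _ ≤ Real.exp (-τ) * τ ^ Δ / Δ.factorial * (1 - Real.exp (-τ)) ^ Δ := by
        gcongr
        exact two_thirds_mul_le_one_sub_exp_neg hτ0 hτ_half
end

section
/- There exists Δ₀ ∈ ℕ such that for every integer Δ ≥ Δ₀, if X is a binomial random variable with parameters Δ and p, where p ≤ exp(−Δ^{0.79}), then P( X ≥ Δ^{0.3} ) ≤ exp(−Δ^{1.08}). -/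
open MeasureTheory

/-- The binomial tail at level `t` is at most `2 ^ n * exp (-(t * s))` when `p ≤ exp (-s)`. -/
theorem measure_binomial_tail_le {Ω : Type*} [MeasurableSpace Ω] (P : Measure Ω) (X : Ω → ℕ)
    (n : ℕ) {p s t : ℝ} (hs : 0 ≤ s) (hp0 : 0 ≤ p) (hp : p ≤ Real.exp (-s))
    (hX : ∀ k : ℕ, P {ω | X ω = k} =
      ENNReal.ofReal ((Nat.choose n k : ℝ) * p ^ k * (1 - p) ^ (n - k))) :
    P {ω | t ≤ (X ω : ℝ)} ≤ ENNReal.ofReal (2 ^ n * Real.exp (-(t * s))) := by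
  have hp1 : p ≤ 1 := hp.trans (Real.exp_le_one_iff.2 (by linarith))
  have hpoint : ∀ k : ℕ, P {ω | t ≤ (X ω : ℝ) ∧ X ω = k} ≤
      ENNReal.ofReal ((Nat.choose n k : ℝ) * Real.exp (-(t * s))) := by
    intro k
    by_cases hk : t ≤ (k : ℝ)
    · calc P {ω | t ≤ (X ω : ℝ) ∧ X ω = k} ≤ P {ω | X ω = k} :=
            measure_mono fun ω h => h.2
        _ = ENNReal.ofReal ((Nat.choose n k : ℝ) * p ^ k * (1 - p) ^ (n - k)) := hX k
        _ ≤ ENNReal.ofReal ((Nat.choose n k : ℝ) * Real.exp (-(t * s))) := by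
          apply ENNReal.ofReal_le_ofReal
          have hpow : p ^ k ≤ Real.exp (-(t * s)) :=
            calc p ^ k ≤ Real.exp (-s) ^ k := pow_le_pow_left₀ hp0 hp k
              _ = Real.exp (k * -s) := (Real.exp_nat_mul _ _).symm
              _ ≤ Real.exp (-(t * s)) := Real.exp_le_exp.2 (by nlinarith)
          calc (Nat.choose n k : ℝ) * p ^ k * (1 - p) ^ (n - k)
              ≤ (Nat.choose n k : ℝ) * p ^ k * 1 := by
                gcongr
                exact pow_le_one₀ (by linarith) (by linarith)
            _ ≤ (Nat.choose n k : ℝ) * Real.exp (-(t * s)) := by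
                rw [mul_one]
                gcongr
    · have hempty : {ω | t ≤ (X ω : ℝ) ∧ X ω = k} = ∅ := by
        ext ω
        simp only [Set.mem_ofPred_eq, Set.mem_empty_iff_false, iff_false]
        rintro ⟨h, rfl⟩
        exact hk h
      simp [hempty]
  have hunion : {ω | t ≤ (X ω : ℝ)} = ⋃ k : ℕ, {ω | t ≤ (X ω : ℝ) ∧ X ω = k} := by
    ext ω
    simp
  calc P {ω | t ≤ (X ω : ℝ)} ≤ ∑' k : ℕ, P {ω | t ≤ (X ω : ℝ) ∧ X ω = k} := by
        rw [hunion]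
        exact measure_iUnion_le _
    _ ≤ ∑' k : ℕ, ENNReal.ofReal ((Nat.choose n k : ℝ) * Real.exp (-(t * s))) :=
        ENNReal.tsum_le_tsum hpoint
    _ = ∑ k ∈ Finset.range (n + 1),
          ENNReal.ofReal ((Nat.choose n k : ℝ) * Real.exp (-(t * s))) := by
        apply tsum_eq_sum
        intro k hk
        rw [Nat.choose_eq_zero_of_lt (by simpa using hk)]
        simp
    _ = ENNReal.ofReal (2 ^ n * Real.exp (-(t * s))) := by
        rw [← ENNReal.ofReal_sum_of_nonneg (fun k _ => by positivity), ← Finset.sum_mul,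
          ← Nat.cast_sum, Nat.sum_range_choose]
        simp

/-- For `Δ` sufficiently large, a binomial random variable `X` with parameters `Δ` and
`p ≤ exp(-Δ^{0.79})` satisfies `P(X ≥ Δ^{0.3}) ≤ exp(-Δ^{1.08})`. -/
theorem binomial_bridging_tail :
    ∃ Δ₀ : ℕ, ∀ Δ : ℕ, Δ₀ ≤ Δ →
      ∀ (Ω : Type) [MeasurableSpace Ω] (P : Measure Ω) [IsProbabilityMeasure P]
        (X : Ω → ℕ) (p : ℝ),
        0 ≤ p → p ≤ Real.exp (-(Δ : ℝ) ^ (0.79 : ℝ)) →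
        (∀ k : ℕ, P {ω | X ω = k} =
          ENNReal.ofReal ((Nat.choose Δ k : ℝ) * p ^ k * (1 - p) ^ (Δ - k))) →
        P {ω | (Δ : ℝ) ^ (0.3 : ℝ) ≤ (X ω : ℝ)} ≤
          ENNReal.ofReal (Real.exp (-(Δ : ℝ) ^ (1.08 : ℝ))) := by
  have hlim := (tendsto_rpow_atTop (show (0 : ℝ) < 0.01 by norm_num)).comp
    (tendsto_natCast_atTop_atTop (R := ℝ))
  obtain ⟨N, hN⟩ := Filter.eventually_atTop.1 (hlim.eventually_ge_atTop 2)
  refine ⟨max N 1, fun Δ hΔ Ω _ P _ X p hp0 hp hX => ?_⟩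
  have h2 : (2 : ℝ) ≤ (Δ : ℝ) ^ (0.01 : ℝ) := hN Δ (le_of_max_le_left hΔ)
  have h1 : (1 : ℝ) ≤ Δ := by exact_mod_cast le_of_max_le_right hΔ
  have hpos : (0 : ℝ) < Δ := by linarith
  refine (measure_binomial_tail_le P X Δ (t := (Δ : ℝ) ^ (0.3 : ℝ))
    (Real.rpow_nonneg hpos.le _) hp0 hp hX).trans (ENNReal.ofReal_le_ofReal ?_)
  have hmul : (Δ : ℝ) ^ (0.3 : ℝ) * (Δ : ℝ) ^ (0.79 : ℝ)
      = (Δ : ℝ) ^ (1.08 : ℝ) * (Δ : ℝ) ^ (0.01 : ℝ) := by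
    rw [← Real.rpow_add hpos, ← Real.rpow_add hpos]
    norm_num
  have hlin : (Δ : ℝ) ≤ (Δ : ℝ) ^ (1.08 : ℝ) :=
    Real.self_le_rpow_of_one_le h1 (by norm_num)
  have htwo : (2 : ℝ) ^ Δ ≤ Real.exp Δ := by
    rw [← Real.exp_one_pow]
    gcongr
    linarith [Real.add_one_le_exp (1 : ℝ)]
  calc (2 : ℝ) ^ Δ * Real.exp (-((Δ : ℝ) ^ (0.3 : ℝ) * (Δ : ℝ) ^ (0.79 : ℝ)))
      ≤ Real.exp Δ * Real.exp (-((Δ : ℝ) ^ (0.3 : ℝ) * (Δ : ℝ) ^ (0.79 : ℝ))) := by gcongr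
    _ = Real.exp (Δ - (Δ : ℝ) ^ (1.08 : ℝ) * (Δ : ℝ) ^ (0.01 : ℝ)) := by
        rw [← Real.exp_add, hmul, sub_eq_add_neg]
    _ ≤ Real.exp (-(Δ : ℝ) ^ (1.08 : ℝ)) := Real.exp_le_exp.2 (by nlinarith)
end
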